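/- Let A be a finitely generated commutative ℂ-algebra that is smooth over ℂ, such that the A-module of Kähler differentials Ω_{A/ℂ} is finitely generated projective of constant rank d and its d-th exterior power ⋀^d_A Ω_{A/ℂ} is a free A-module of rank 1 (trivial canonical module). Regard A as a module over A ⊗_ℂ A via the multiplication map. Then Ext^n_{A⊗_ℂA}(A, A ⊗_ℂ A) = 0 for all n ≠ d, and Ext^d_{A⊗_ℂA}(A, A ⊗_ℂ A) is isomorphic to A as an A-module, where the A-module structure on the Ext group is induced by the internal A-module structure on A ⊗_ℂ A. In other words, A is a Calabi–Yau algebra of dimension d and its Van den Bergh dualizing module is free of rank 1. -/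

import Mathlib

open CategoryTheory CategoryTheory.Limits TensorProduct

section ExteriorOperators

variable {A E : Type*} [CommRing A] [AddCommGroup E] [Module A E]

open CliffordAlgebra in
theorem ExteriorAlgebra.contractLeft_mem_exteriorPower (l : Module.Dual A E) (n : ℕ)
    {z : ExteriorAlgebra A E} (hz : z ∈ ⋀[A]^(n + 1) E) :
    contractLeft (Q := (0 : QuadraticForm A E)) l z ∈ ⋀[A]^n E := by
  induction n generalizing z with
  | zero =>
    rw [zero_add, exteriorPower, pow_one] at hz
    obtain ⟨v, rfl⟩ := hz
    rw [exteriorPower, pow_zero, ExteriorAlgebra.ι, contractLeft_ι]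
    exact Submodule.algebraMap_mem _
  | succ n ih =>
    rw [exteriorPower, pow_succ'] at hz
    induction hz using Submodule.mul_induction_on' with
    | mem_mul_mem v hv y hy =>
      obtain ⟨v, rfl⟩ := hv
      rw [ExteriorAlgebra.ι, contractLeft_ι_mul]
      refine Submodule.sub_mem _ (Submodule.smul_mem _ _ hy) ?_
      rw [exteriorPower, pow_succ']
      exact Submodule.mul_mem_mul ⟨v, rfl⟩ (ih hy)
    | add x _ y _ hx hy => rw [map_add]; exact Submodule.add_mem _ hx hy

theorem ExteriorAlgebra.ι_mul_mem_exteriorPower (v : E) (n : ℕ)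
    {z : ExteriorAlgebra A E} (hz : z ∈ ⋀[A]^n E) :
    ExteriorAlgebra.ι A v * z ∈ ⋀[A]^(n + 1) E := by
  rw [exteriorPower, pow_succ']
  exact Submodule.mul_mem_mul ⟨v, rfl⟩ hz

/-- For a dual basis `(e, l)` of `E`, the operator `∑ eⱼ ∧ (lⱼ ⌋ -)` is multiplication by the
degree. -/
theorem ExteriorAlgebra.sum_ι_mul_contractLeft {κ : Type*} [Fintype κ] (e : κ → E)
    (l : κ → Module.Dual A E) (hel : ∀ v, ∑ j, l j v • e j = v) (n : ℕ)
    {z : ExteriorAlgebra A E} (hz : z ∈ ⋀[A]^n E) :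
    ∑ j, ExteriorAlgebra.ι A (e j) *
      CliffordAlgebra.contractLeft (Q := (0 : QuadraticForm A E)) (l j) z = (n : A) • z := by
  induction n generalizing z with
  | zero =>
    rw [exteriorPower, pow_zero, Submodule.mem_one] at hz
    obtain ⟨a, rfl⟩ := hz
    simp [CliffordAlgebra.contractLeft_algebraMap]
  | succ n ih =>
    rw [exteriorPower, pow_succ'] at hz
    induction hz using Submodule.mul_induction_on' with
    | mem_mul_mem v hv y hy =>
      obtain ⟨v, rfl⟩ := hv
      have h1 : ∀ j, ExteriorAlgebra.ι A (e j) *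
          CliffordAlgebra.contractLeft (Q := (0 : QuadraticForm A E)) (l j)
            (ExteriorAlgebra.ι A v * y) =
          ExteriorAlgebra.ι A (l j v • e j) * y + ExteriorAlgebra.ι A v *
            (ExteriorAlgebra.ι A (e j) *
              CliffordAlgebra.contractLeft (Q := (0 : QuadraticForm A E)) (l j) y) := by
        intro j
        have h2 : ExteriorAlgebra.ι A (e j) * ExteriorAlgebra.ι A v =
            - (ExteriorAlgebra.ι A v * ExteriorAlgebra.ι A (e j)) :=
          eq_neg_of_add_eq_zero_left (ExteriorAlgebra.ι_add_mul_swap _ _)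
        rw [ExteriorAlgebra.ι, CliffordAlgebra.contractLeft_ι_mul, ← ExteriorAlgebra.ι, mul_sub,
          ← mul_assoc, h2, map_smul, mul_smul_comm, smul_mul_assoc, neg_mul, sub_neg_eq_add,
          mul_assoc]
      simp_rw [h1]
      rw [Finset.sum_add_distrib, ← Finset.sum_mul, ← map_sum, hel, ← Finset.mul_sum, ih hy,
        Nat.cast_succ, add_smul, one_smul, mul_smul_comm, add_comm]
    | add x _ y _ hx hy =>
      simp_rw [map_add, mul_add, Finset.sum_add_distrib]
      rw [hx, hy, smul_add]

namespace exteriorPower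

/-- Contraction of exterior powers with a linear form. -/
def contraction (l : Module.Dual A E) (n : ℕ) : ⋀[A]^(n + 1) E →ₗ[A] ⋀[A]^n E :=
  (CliffordAlgebra.contractLeft (Q := (0 : QuadraticForm A E)) l).restrict
    fun _ hz ↦ ExteriorAlgebra.contractLeft_mem_exteriorPower l n hz

/-- Left exterior multiplication of exterior powers by a vector. -/
def wedge (v : E) (n : ℕ) : ⋀[A]^n E →ₗ[A] ⋀[A]^(n + 1) E :=
  (LinearMap.mulLeft A (ExteriorAlgebra.ι A v)).restrict
    fun _ hz ↦ ExteriorAlgebra.ι_mul_mem_exteriorPower v n hz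

theorem contraction_wedge (l : Module.Dual A E) (v : E) (n : ℕ) (z : ⋀[A]^(n + 1) E) :
    contraction l (n + 1) (wedge v (n + 1) z) = l v • z - wedge v n (contraction l n z) :=
  Subtype.ext (CliffordAlgebra.contractLeft_ι_mul l v z.1)

theorem contraction_wedge_zero (l : Module.Dual A E) (v : E) (z : ⋀[A]^0 E) :
    contraction l 0 (wedge v 0 z) = l v • z := by
  obtain ⟨z, hz⟩ := z
  obtain ⟨a, rfl⟩ := Submodule.mem_one.1
    (by simpa only [ExteriorAlgebra.exteriorPower, pow_zero] using hz)
  apply Subtype.ext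
  change CliffordAlgebra.contractLeft (Q := (0 : QuadraticForm A E)) l
    (ExteriorAlgebra.ι A v * algebraMap A (ExteriorAlgebra A E) a) =
      l v • algebraMap A (ExteriorAlgebra A E) a
  rw [ExteriorAlgebra.ι, CliffordAlgebra.contractLeft_ι_mul,
    CliffordAlgebra.contractLeft_algebraMap, mul_zero, sub_zero]

theorem contraction_comm (l l' : Module.Dual A E) (n : ℕ) (z : ⋀[A]^(n + 2) E) :
    contraction l n (contraction l' (n + 1) z) = - contraction l' n (contraction l (n + 1) z) :=
  Subtype.ext (CliffordAlgebra.contractLeft_comm (Q := (0 : QuadraticForm A E)) l l' z.1)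

theorem sum_wedge_contraction {κ : Type*} [Fintype κ] (e : κ → E)
    (l : κ → Module.Dual A E) (hel : ∀ v, ∑ j, l j v • e j = v) (n : ℕ) (z : ⋀[A]^(n + 1) E) :
    ∑ j, wedge (e j) n (contraction (l j) n z) = ((n + 1 : ℕ) : A) • z := by
  refine Subtype.ext (.trans ?_ (ExteriorAlgebra.sum_ι_mul_contractLeft e l hel (n + 1) z.2))
  rw [AddSubmonoidClass.coe_finsetSum]
  rfl

theorem contraction_sum_smul {κ : Type*} [Fintype κ] (a : κ → A) (l : κ → Module.Dual A E)
    (n : ℕ) (z : ⋀[A]^(n + 1) E) :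
    contraction (∑ j, a j • l j) n z = ∑ j, a j • contraction (l j) n z := by
  apply Subtype.ext
  rw [AddSubmonoidClass.coe_finsetSum]
  simp [contraction]

instance projective [Module.Finite A E] [Module.Projective A E] (n : ℕ) :
    Module.Projective A (⋀[A]^n E) := by
  obtain ⟨N, f, g, -, -, hfg⟩ := Module.Finite.exists_comp_eq_id_of_projective A E
  refine Module.Projective.of_split (map n g) (map n f) ?_
  rw [← map_comp, hfg, map_id]

end exteriorPower

end ExteriorOperators

section Koszul

variable {A B E : Type*} [CommRing A] [CommRing B] [Algebra A B] [AddCommGroup E] [Module A E]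

/-- A cosection `σ : E → I ⊆ B` of a finite projective module with dual basis `(e, l)`, together
with derivations `∂ₖ` of `B` such that `∑ σ(eₖ) ∂ₖ` is an Euler vector field along `V(I)`. -/
structure EulerCosection (E : Type*) [AddCommGroup E] [Module A E] (I : Ideal B)
    (κ : Type*) [Fintype κ] where
  /-- the generators of the dual basis -/
  e : κ → E
  /-- the linear forms of the dual basis -/
  l : κ → Module.Dual A E
  sum_l_smul_e : ∀ v, ∑ j, l j v • e j = v
  /-- the cosection -/
  σ : E →ₗ[A] B
  σ_mem : ∀ v, σ v ∈ I
  /-- the derivations -/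
  der : κ → Derivation A B B
  der_σ : ∀ k v, der k (σ v) - algebraMap A B (l k v) ∈ I
  euler : ∀ y ∈ I, ∑ k, σ (e k) * der k y - y ∈ I ^ 2

namespace EulerCosection

open exteriorPower

variable {I : Ideal B} {κ : Type*} [Fintype κ] (S : EulerCosection (A := A) E I κ)

include S in
theorem euler_pow (m : ℕ) {y : B} (hy : y ∈ I ^ m) :
    ∑ k, S.σ (S.e k) * S.der k y - m * y ∈ I ^ (m + 1) := by
  let ξ : Derivation A B B := ∑ k, S.σ (S.e k) • S.der k
  have hξ : ∀ y, ∑ k, S.σ (S.e k) * S.der k y = ξ y := fun y ↦ by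
    have h := congrFun (map_sum Derivation.coeFnAddMonoidHom
      (fun k ↦ S.σ (S.e k) • S.der k) Finset.univ) y
    rw [Finset.sum_apply] at h
    exact h.symm
  have h1 : ∀ y ∈ I, ξ y - y ∈ I ^ 2 := fun y hy ↦ hξ y ▸ S.euler y hy
  rw [hξ]
  induction m generalizing y with
  | zero =>
    simp only [Nat.cast_zero, zero_mul, sub_zero, zero_add, pow_one]
    rw [← hξ]
    exact Ideal.sum_mem _ fun k _ ↦ Ideal.mul_mem_right _ _ (S.σ_mem _)
  | succ m ih =>
    rw [pow_succ] at hy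
    induction hy using Submodule.mul_induction_on' with
    | mem_mul_mem a ha b hb =>
      have h2 : ξ (a * b) - (m + 1 : ℕ) * (a * b) = a * (ξ b - b) + (ξ a - m * a) * b := by
        rw [Derivation.leibniz, smul_eq_mul, smul_eq_mul]; push_cast; ring
      rw [h2]
      refine Ideal.add_mem _ ?_ ?_
      · rw [show m + 1 + 1 = m + 2 from rfl, pow_add]
        exact Ideal.mul_mem_mul ha (h1 b hb)
      · rw [pow_succ]
        exact Ideal.mul_mem_mul (ih ha) hb
    | add a _ b _ ha hb =>
      have h2 : ξ (a + b) - (m + 1 : ℕ) * (a + b) =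
        (ξ a - (m + 1 : ℕ) * a) + (ξ b - (m + 1 : ℕ) * b) := by rw [map_add]; ring
      rw [h2]
      exact Ideal.add_mem _ ha hb

theorem sum_l_smul_σ (v : E) : ∑ j, S.l j v • S.σ (S.e j) = S.σ v := by
  simp_rw [← map_smul]
  rw [← map_sum, S.sum_l_smul_e]

theorem sum_l_smul_l (k : κ) : ∑ j, S.l k (S.e j) • S.l j = S.l k := by
  ext v
  conv_rhs => rw [← S.sum_l_smul_e v]
  simp [mul_comm]

/-- The Koszul differential attached to `S.σ`. -/
noncomputable def koszulD (n : ℕ) : B ⊗[A] (⋀[A]^(n + 1) E) →ₗ[B] B ⊗[A] (⋀[A]^n E) :=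
  ∑ j, S.σ (S.e j) • (contraction (S.l j) n).baseChange B

/-- The de Rham type operator attached to the derivations `S.der`. -/
noncomputable def deRham (n : ℕ) : B ⊗[A] (⋀[A]^n E) →ₗ[A] B ⊗[A] (⋀[A]^(n + 1) E) :=
  ∑ k, TensorProduct.map (S.der k).toLinearMap (wedge (S.e k) n)

theorem koszulD_tmul (n : ℕ) (y : B) (w : ⋀[A]^(n + 1) E) :
    S.koszulD n (y ⊗ₜ w) = ∑ j, (S.σ (S.e j) * y) ⊗ₜ contraction (S.l j) n w := by
  simp [koszulD, LinearMap.sum_apply, smul_tmul']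

theorem deRham_tmul (n : ℕ) (y : B) (w : ⋀[A]^n E) :
    S.deRham n (y ⊗ₜ w) = ∑ k, S.der k y ⊗ₜ wedge (S.e k) n w := by
  simp [deRham, LinearMap.sum_apply]

theorem koszulD_koszulD (h2 : IsUnit (2 : B)) (n : ℕ) (z : B ⊗[A] (⋀[A]^(n + 2) E)) :
    S.koszulD n (S.koszulD (n + 1) z) = 0 := by
  induction z with
  | zero => simp
  | add z w hz hw => rw [map_add, map_add, hz, hw, add_zero]
  | tmul y w =>
    have h3 : S.koszulD n (S.koszulD (n + 1) (y ⊗ₜ w)) =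
        ∑ j, ∑ k, (S.σ (S.e k) * (S.σ (S.e j) * y)) ⊗ₜ
          contraction (S.l k) n (contraction (S.l j) (n + 1) w) := by
      rw [koszulD_tmul, map_sum]
      simp_rw [koszulD_tmul]
    have h4 : S.koszulD n (S.koszulD (n + 1) (y ⊗ₜ w)) =
        - S.koszulD n (S.koszulD (n + 1) (y ⊗ₜ w)) := by
      conv_rhs => rw [h3, Finset.sum_comm]
      rw [h3, ← Finset.sum_neg_distrib]
      refine Finset.sum_congr rfl fun j _ ↦ ?_
      rw [← Finset.sum_neg_distrib]
      refine Finset.sum_congr rfl fun k _ ↦ ?_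
      rw [contraction_comm, tmul_neg, mul_left_comm]
    rw [eq_neg_iff_add_eq_zero, ← two_smul B] at h4
    exact h2.smul_eq_zero.1 h4

theorem tmul_mem_smul_top {M : Type*} [AddCommGroup M] [Module A M] {J : Ideal B} {y : B}
    (hy : y ∈ J) (w : M) : y ⊗ₜ[A] w ∈ (J • ⊤ : Submodule B (B ⊗[A] M)) := by
  rw [← mul_one y, ← smul_eq_mul, ← smul_tmul']
  exact Submodule.smul_mem_smul hy Submodule.mem_top

theorem smul_top_tmul_induction {M : Type*} [AddCommGroup M] [Module A M] {J : Ideal B}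
    {p : B ⊗[A] M → Prop} (h0 : p 0) (hadd : ∀ z w, p z → p w → p (z + w))
    (htmul : ∀ y ∈ J, ∀ w : M, p (y ⊗ₜ w)) {z : B ⊗[A] M}
    (hz : z ∈ (J • ⊤ : Submodule B (B ⊗[A] M))) : p z := by
  refine Submodule.smul_induction_on hz (fun r hr m _ ↦ ?_) hadd
  induction m with
  | zero => rwa [smul_zero]
  | add z w hz hw =>
    rw [smul_add]
    exact hadd _ _ (hz Submodule.mem_top) (hw Submodule.mem_top)
  | tmul y w =>
    rw [smul_tmul']
    exact htmul _ (Ideal.mul_mem_right _ _ hr) _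

include S in
theorem sum_sum_σ_mul_der (y : B) :
    ∑ j, ∑ k, S.l j (S.e k) • (S.σ (S.e j) * S.der k y) = ∑ k, S.σ (S.e k) * S.der k y := by
  rw [Finset.sum_comm]
  refine Finset.sum_congr rfl fun k _ ↦ ?_
  simp_rw [← smul_mul_assoc]
  rw [← Finset.sum_mul, S.sum_l_smul_σ]

/-- Cartan's formula, in positive degree: up to higher order, `D h + h D` is multiplication by
the total weight. -/
theorem koszulD_deRham_add (n k : ℕ) {z : B ⊗[A] (⋀[A]^(n + 1) E)}
    (hz : z ∈ (I ^ k • ⊤ : Submodule B (B ⊗[A] (⋀[A]^(n + 1) E)))) :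
    S.koszulD (n + 1) (S.deRham (n + 1) z) + S.deRham n (S.koszulD n z) -
      ((k + (n + 1) : ℕ) : B) • z ∈
      (I ^ (k + 1) • ⊤ : Submodule B (B ⊗[A] (⋀[A]^(n + 1) E))) := by
  refine smul_top_tmul_induction (p := fun z ↦ S.koszulD (n + 1) (S.deRham (n + 1) z) +
    S.deRham n (S.koszulD n z) - ((k + (n + 1) : ℕ) : B) • z ∈
      (I ^ (k + 1) • ⊤ : Submodule B (B ⊗[A] (⋀[A]^(n + 1) E)))) (by simp) ?_ ?_ hz
  · intro z w hz hw
    convert Submodule.add_mem _ hz hw using 1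
    simp only [map_add, smul_add]
    abel
  · intro y hy w
    have h1 : S.koszulD (n + 1) (S.deRham (n + 1) (y ⊗ₜ w)) + S.deRham n (S.koszulD n (y ⊗ₜ w)) =
        (∑ k, S.σ (S.e k) * S.der k y) ⊗ₜ w +
        ∑ j, ∑ k, (y * S.der k (S.σ (S.e j))) ⊗ₜ
          wedge (S.e k) n (contraction (S.l j) n w) := by
      rw [← S.sum_sum_σ_mul_der]
      simp_rw [deRham_tmul, koszulD_tmul, map_sum, koszulD_tmul, deRham_tmul, contraction_wedge,
        Derivation.leibniz, tmul_sub, smul_eq_mul, add_tmul, tmul_smul, smul_tmul']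
      rw [Finset.sum_comm, sum_tmul]
      simp_rw [sum_tmul, Finset.sum_sub_distrib, Finset.sum_add_distrib]
      abel
    have h2 : ((n + 1 : ℕ) : B) • y ⊗ₜ[A] w = ∑ j, ∑ k,
        (y * algebraMap A B (S.l k (S.e j))) ⊗ₜ wedge (S.e k) n (contraction (S.l j) n w) := by
      have h3 : ∀ k, contraction (S.l k) n w =
          ∑ j, S.l k (S.e j) • contraction (S.l j) n w := fun k ↦ by
        conv_lhs => rw [← S.sum_l_smul_l k, contraction_sum_smul]
      have h4 := sum_wedge_contraction S.e S.l S.sum_l_smul_e n w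
      have h5 : ((n + 1 : ℕ) : B) • y ⊗ₜ[A] w = y ⊗ₜ (((n + 1 : ℕ) : A) • w) := by
        rw [Nat.cast_smul_eq_nsmul, Nat.cast_smul_eq_nsmul, tmul_smul]
      rw [h5, ← h4, tmul_sum, Finset.sum_comm]
      refine Finset.sum_congr rfl fun k _ ↦ ?_
      conv_lhs => rw [h3 k, map_sum, tmul_sum]
      refine Finset.sum_congr rfl fun j _ ↦ ?_
      rw [map_smul, tmul_smul, smul_tmul', mul_comm y, ← Algebra.smul_def]
    have h6 : S.koszulD (n + 1) (S.deRham (n + 1) (y ⊗ₜ w)) +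
        S.deRham n (S.koszulD n (y ⊗ₜ w)) - ((k + (n + 1) : ℕ) : B) • y ⊗ₜ[A] w =
        (∑ k, S.σ (S.e k) * S.der k y - k * y) ⊗ₜ w +
        ∑ j, ∑ k, (y * (S.der k (S.σ (S.e j)) - algebraMap A B (S.l k (S.e j)))) ⊗ₜ
          wedge (S.e k) n (contraction (S.l j) n w) := by
      simp_rw [mul_sub, sub_tmul, Finset.sum_sub_distrib]
      rw [h1, ← h2, Nat.cast_add, add_smul, smul_tmul' (k : B), smul_eq_mul]
      abel
    rw [h6]
    refine Submodule.add_mem _ (tmul_mem_smul_top (S.euler_pow k hy) w) ?_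
    refine Submodule.sum_mem _ fun j _ ↦ Submodule.sum_mem _ fun i _ ↦ tmul_mem_smul_top ?_ _
    rw [pow_succ]
    exact Ideal.mul_mem_mul hy (S.der_σ _ _)

theorem koszulD_deRham_zero (k : ℕ) {z : B ⊗[A] (⋀[A]^0 E)}
    (hz : z ∈ (I ^ k • ⊤ : Submodule B (B ⊗[A] (⋀[A]^0 E)))) :
    S.koszulD 0 (S.deRham 0 z) - (k : B) • z ∈
      (I ^ (k + 1) • ⊤ : Submodule B (B ⊗[A] (⋀[A]^0 E))) := by
  refine smul_top_tmul_induction (p := fun z ↦ S.koszulD 0 (S.deRham 0 z) - (k : B) • z ∈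
      (I ^ (k + 1) • ⊤ : Submodule B (B ⊗[A] (⋀[A]^0 E)))) (by simp) ?_ ?_ hz
  · intro z w hz hw
    convert Submodule.add_mem _ hz hw using 1
    simp only [map_add, smul_add]
    abel
  · intro y hy w
    have h1 : S.koszulD 0 (S.deRham 0 (y ⊗ₜ w)) = (∑ k, S.σ (S.e k) * S.der k y) ⊗ₜ w := by
      rw [← S.sum_sum_σ_mul_der]
      simp_rw [deRham_tmul, map_sum, koszulD_tmul, contraction_wedge_zero, tmul_smul, smul_tmul']
      rw [Finset.sum_comm, sum_tmul]
      simp_rw [sum_tmul]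
    rw [h1, smul_tmul', smul_eq_mul, ← sub_tmul]
    exact tmul_mem_smul_top (S.euler_pow k hy) w

end EulerCosection

end Koszul

section Krull

variable {B V : Type*} [CommRing B] [AddCommGroup V] [Module B V]

/-- Successive approximation of the elements of `Z` by elements of `W`, combined with Krull's
intersection theorem. -/
theorem Ideal.exists_smul_mem_of_approx [IsNoetherianRing B] [Module.Finite B V] (I : Ideal B)
    (Z W : Submodule B V) (hWZ : W ≤ Z) (F : ℕ → V → Prop)
    (hF : ∀ k z, F k z → z ∈ (I ^ k • ⊤ : Submodule B V)) (h0 : ∀ z ∈ Z, F 0 z)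
    (h : ∀ k, ∀ z ∈ Z, F k z → ∃ w ∈ W, F (k + 1) (z - w)) :
    ∃ f : B, f - 1 ∈ I ∧ ∀ z ∈ Z, f • z ∈ W := by
  have happ : ∀ z ∈ Z, ∀ k, ∃ w ∈ W, F k (z - w) := by
    intro z hz k
    induction k with
    | zero => exact ⟨0, W.zero_mem, by simpa using h0 z hz⟩
    | succ k ih =>
      obtain ⟨w, hw, hwk⟩ := ih
      obtain ⟨w', hw', hwk'⟩ := h k _ (Z.sub_mem hz (hWZ hw)) hwk
      exact ⟨w + w', W.add_mem hw hw', by rwa [← sub_sub]⟩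
  have hmem : ∀ z ∈ Z, W.mkQ z ∈ (⨅ i : ℕ, I ^ i • ⊤ : Submodule B (V ⧸ W)) := by
    intro z hz
    rw [Submodule.mem_iInf]
    intro k
    obtain ⟨w, hw, hwk⟩ := happ z hz k
    have h1 : W.mkQ z = W.mkQ (z - w) := by
      rw [map_sub, Submodule.mkQ_apply _ w, (Submodule.Quotient.mk_eq_zero W).2 hw, sub_zero]
    have h2 := Submodule.mem_map_of_mem (f := W.mkQ) (hF k _ hwk)
    rw [Submodule.map_smul''] at h2
    exact h1 ▸ Submodule.smul_mono le_rfl le_top h2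
  obtain ⟨r, hr, hrN⟩ := Submodule.exists_mem_and_smul_eq_self_of_fg_of_le_smul I
    (⨅ i : ℕ, I ^ i • ⊤ : Submodule B (V ⧸ W)) (IsNoetherian.noetherian _) fun x hx ↦ by
      obtain ⟨r, hr⟩ := (I.mem_iInf_smul_pow_eq_bot_iff x).1 hx
      exact hr ▸ Submodule.smul_mem_smul r.2 hx
  refine ⟨1 - r, by simpa using hr, fun z hz ↦ ?_⟩
  rw [← Submodule.Quotient.mk_eq_zero, ← Submodule.mkQ_apply, map_smul, sub_smul, one_smul,
    hrN _ (hmem z hz), sub_self]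

theorem Module.Dual.mem_smul_top_of_forall_mem [Module.Finite B V] [Module.Projective B V]
    {J : Ideal B} {φ : Module.Dual B V} (hφ : ∀ v, φ v ∈ J) :
    φ ∈ (J • ⊤ : Submodule B (Module.Dual B V)) := by
  obtain ⟨N, f, g, -, -, hfg⟩ := Module.Finite.exists_comp_eq_id_of_projective B V
  have h1 : φ = ∑ i, φ (f (Pi.single i 1)) • (LinearMap.proj i ∘ₗ g) := by
    ext v
    conv_lhs => rw [← LinearMap.id_apply (R := B) v, ← hfg, LinearMap.comp_apply,
      pi_eq_sum_univ' (g v), map_sum, map_sum]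
    simp [LinearMap.sum_apply, mul_comm]
  rw [h1]
  exact Submodule.sum_mem _ fun i _ ↦ Submodule.smul_mem_smul (hφ _) Submodule.mem_top

end Krull

namespace EulerCosection

open exteriorPower

variable {A B E : Type*} [CommRing A] [CommRing B] [Algebra A B] [AddCommGroup E] [Module A E]
variable {I : Ideal B} {κ : Type*} [Fintype κ] (S : EulerCosection (A := A) E I κ)

theorem koszulD_mem_smul_top (n : ℕ) (z : B ⊗[A] (⋀[A]^(n + 1) E)) :
    S.koszulD n z ∈ (I • ⊤ : Submodule B (B ⊗[A] (⋀[A]^n E))) := by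
  rw [koszulD, LinearMap.sum_apply]
  exact Submodule.sum_mem _ fun j _ ↦ Submodule.smul_mem_smul (S.σ_mem _) Submodule.mem_top

section Chains

variable [IsNoetherianRing B] [Module.Finite A E] (hB : ∀ n : ℕ, n ≠ 0 → IsUnit (n : B))

include hB in
theorem exists_smul_mem_range_zero :
    ∃ f : B, f - 1 ∈ I ∧ ∀ z ∈ (I • ⊤ : Submodule B (B ⊗[A] (⋀[A]^0 E))),
      f • z ∈ LinearMap.range (S.koszulD 0) := by
  refine Ideal.exists_smul_mem_of_approx I _ _ ?_
    (fun k z ↦ z ∈ (I ^ (k + 1) • ⊤ : Submodule B (B ⊗[A] (⋀[A]^0 E))))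
    (fun k z hz ↦ Submodule.smul_mono_left (Ideal.pow_le_pow_right k.le_succ) hz)
    (fun z hz ↦ by simpa using hz) ?_
  · rintro _ ⟨z, rfl⟩
    exact S.koszulD_mem_smul_top 0 z
  · intro k z _ hz
    obtain ⟨u, hu⟩ := hB (k + 1) k.succ_ne_zero
    refine ⟨(↑u⁻¹ : B) • S.koszulD 0 (S.deRham 0 z), Submodule.smul_mem _ _ ⟨_, rfl⟩, ?_⟩
    have h1 := Submodule.smul_mem _ (-(↑u⁻¹ : B)) (S.koszulD_deRham_zero (k + 1) hz)
    rw [← hu, smul_sub, smul_smul, neg_smul, neg_mul, Units.inv_mul, neg_smul, one_smul] at h1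
    convert h1 using 1
    abel

include hB in
theorem exists_smul_mem_range_succ (n : ℕ) :
    ∃ f : B, f - 1 ∈ I ∧ ∀ z, S.koszulD n z = 0 →
      f • z ∈ LinearMap.range (S.koszulD (n + 1)) := by
  refine Ideal.exists_smul_mem_of_approx I (LinearMap.ker (S.koszulD n)) _ ?_
    (fun k z ↦ z ∈ (I ^ k • ⊤ : Submodule B (B ⊗[A] (⋀[A]^(n + 1) E)))) (fun _ _ hz ↦ hz)
    (fun z _ ↦ by simp) ?_
  · rintro _ ⟨z, rfl⟩
    exact S.koszulD_koszulD (by simpa using hB 2 two_ne_zero) n z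
  · intro k z hz hzk
    obtain ⟨u, hu⟩ := hB (k + (n + 1)) (by omega)
    refine ⟨(↑u⁻¹ : B) • S.koszulD (n + 1) (S.deRham (n + 1) z),
      Submodule.smul_mem _ _ ⟨_, rfl⟩, ?_⟩
    have h1 := Submodule.smul_mem _ (-(↑u⁻¹ : B)) (S.koszulD_deRham_add n k hzk)
    rw [LinearMap.mem_ker.1 hz, map_zero, add_zero,
      ← hu, smul_sub, smul_smul, neg_smul, neg_mul, Units.inv_mul, neg_smul, one_smul] at h1
    convert h1 using 1
    abel

end Chains

section Cochains

/-- The homotopy on cochains attached to the derivations `S.der`. -/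
noncomputable def coDeRham (n : ℕ) (φ : B ⊗[A] (⋀[A]^(n + 1) E) →ₗ[B] B) :
    B ⊗[A] (⋀[A]^n E) →ₗ[B] B :=
  LinearMap.liftBaseChange B (∑ k, (S.der k).toLinearMap ∘ₗ
    ((φ.restrictScalars A) ∘ₗ TensorProduct.mk A B _ 1) ∘ₗ wedge (S.e k) n)

theorem coDeRham_tmul (n : ℕ) (φ : B ⊗[A] (⋀[A]^(n + 1) E) →ₗ[B] B) (w : ⋀[A]^n E) :
    S.coDeRham n φ (1 ⊗ₜ w) = ∑ k, S.der k (φ (1 ⊗ₜ wedge (S.e k) n w)) := by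
  simp [coDeRham, LinearMap.sum_apply]

theorem apply_koszulD_tmul (n : ℕ) (φ : B ⊗[A] (⋀[A]^n E) →ₗ[B] B) (w : ⋀[A]^(n + 1) E) :
    φ (S.koszulD n (1 ⊗ₜ w)) = ∑ j, S.σ (S.e j) * φ (1 ⊗ₜ contraction (S.l j) n w) := by
  rw [koszulD, LinearMap.sum_apply, map_sum]
  simp

theorem forall_mem_of_forall_tmul {n : ℕ} {J : Ideal B} {φ : B ⊗[A] (⋀[A]^n E) →ₗ[B] B}
    (h : ∀ w, φ (1 ⊗ₜ w) ∈ J) (z) : φ z ∈ J := by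
  induction z with
  | zero => simp
  | add z w hz hw => rw [map_add]; exact J.add_mem hz hw
  | tmul y w =>
    rw [← mul_one y, ← smul_eq_mul, ← smul_tmul', map_smul]
    exact J.mul_mem_left _ (h w)

variable {d : ℕ} (hd : ∑ k, S.l k (S.e k) = d)

include S in
theorem sum_sum_mul_contraction_wedge {n : ℕ} (φ : B ⊗[A] (⋀[A]^n E) →ₗ[B] B) (w : ⋀[A]^n E) :
    ∑ k, ∑ j, algebraMap A B (S.l k (S.e j)) *
      φ (1 ⊗ₜ contraction (S.l j) n (wedge (S.e k) n w)) =
    ∑ k, φ (1 ⊗ₜ contraction (S.l k) n (wedge (S.e k) n w)) := by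
  refine Finset.sum_congr rfl fun k _ ↦ ?_
  conv_rhs => rw [← S.sum_l_smul_l k, contraction_sum_smul, tmul_sum, map_sum]
  refine Finset.sum_congr rfl fun j _ ↦ ?_
  rw [tmul_smul, ← algebraMap_smul B, map_smul, smul_eq_mul]

include hd in
theorem smul_sub_coDeRham_succ (n m k : ℕ) (hm : n + 1 + m = d)
    {φ : B ⊗[A] (⋀[A]^(n + 1) E) →ₗ[B] B} (hφ : φ ∘ₗ S.koszulD (n + 1) = 0)
    (hφk : ∀ z, φ z ∈ I ^ k) (z) :
    (((k + m : ℕ) : B) • φ - S.coDeRham n φ ∘ₗ S.koszulD n) z ∈ I ^ (k + 1) := by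
  refine forall_mem_of_forall_tmul (fun w ↦ ?_) z
  have h1 : ∀ i, ∑ j, S.σ (S.e j) *
      φ (1 ⊗ₜ contraction (S.l j) (n + 1) (wedge (S.e i) (n + 1) w)) = 0 := fun i ↦ by
    rw [← apply_koszulD_tmul]
    exact LinearMap.congr_fun hφ _
  have h2 : ∑ i, S.der i (∑ j, S.σ (S.e j) *
      φ (1 ⊗ₜ contraction (S.l j) (n + 1) (wedge (S.e i) (n + 1) w))) = 0 := by
    simp [h1]
  simp_rw [map_sum, Derivation.leibniz, smul_eq_mul, Finset.sum_add_distrib] at h2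
  have h3 : ∑ i, ∑ j, S.σ (S.e j) * S.der i (φ (1 ⊗ₜ contraction (S.l j) (n + 1)
      (wedge (S.e i) (n + 1) w))) = ∑ i, S.σ (S.e i) * S.der i (φ (1 ⊗ₜ w)) -
        S.coDeRham n φ (S.koszulD n (1 ⊗ₜ w)) := by
    rw [← S.sum_sum_σ_mul_der, apply_koszulD_tmul, Finset.sum_comm, ← Finset.sum_sub_distrib]
    refine Finset.sum_congr rfl fun j _ ↦ ?_
    rw [coDeRham_tmul, Finset.mul_sum, ← Finset.sum_sub_distrib]
    refine Finset.sum_congr rfl fun i _ ↦ ?_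
    rw [contraction_wedge, tmul_sub, map_sub, map_sub, mul_sub, tmul_smul, ← mul_smul_comm,
      ← Derivation.map_smul, ← algebraMap_smul B (S.l j (S.e i)) (1 ⊗ₜ[A] w), map_smul,
      algebraMap_smul]
  have h4 : ∑ i, ∑ j, algebraMap A B (S.l i (S.e j)) *
      φ (1 ⊗ₜ contraction (S.l j) (n + 1) (wedge (S.e i) (n + 1) w)) = m * φ (1 ⊗ₜ w) := by
    rw [S.sum_sum_mul_contraction_wedge, ← map_sum, ← tmul_sum]
    simp_rw [contraction_wedge]
    rw [Finset.sum_sub_distrib, sum_wedge_contraction S.e S.l S.sum_l_smul_e, ← Finset.sum_smul,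
      hd, ← hm, ← sub_smul, Nat.cast_add (n + 1), add_sub_cancel_left, Nat.cast_smul_eq_nsmul,
      tmul_smul, map_nsmul, nsmul_eq_mul]
  have h5 : (((k + m : ℕ) : B) • φ - S.coDeRham n φ ∘ₗ S.koszulD n) (1 ⊗ₜ w) =
      - ((∑ i, S.σ (S.e i) * S.der i (φ (1 ⊗ₜ w)) - k * φ (1 ⊗ₜ w)) +
        ∑ i, ∑ j, φ (1 ⊗ₜ contraction (S.l j) (n + 1) (wedge (S.e i) (n + 1) w)) *
          (S.der i (S.σ (S.e j)) - algebraMap A B (S.l i (S.e j)))) := by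
    simp_rw [mul_sub, Finset.sum_sub_distrib]
    simp_rw [mul_comm _ (algebraMap A B _), h4]
    rw [h3] at h2
    simp only [LinearMap.sub_apply, LinearMap.smul_apply, LinearMap.comp_apply, smul_eq_mul,
      Nat.cast_add]
    linear_combination h2
  rw [h5]
  refine Ideal.neg_mem_iff _ |>.2 (Ideal.add_mem _ (S.euler_pow k (hφk _)) ?_)
  refine Ideal.sum_mem _ fun i _ ↦ Ideal.sum_mem _ fun j _ ↦ ?_
  rw [pow_succ]
  exact Ideal.mul_mem_mul (hφk _) (S.der_σ _ _)

include hd in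
theorem smul_mem_zero (k : ℕ) {φ : B ⊗[A] (⋀[A]^0 E) →ₗ[B] B} (hφ : φ ∘ₗ S.koszulD 0 = 0)
    (hφk : ∀ z, φ z ∈ I ^ k) (z) : (((k + d : ℕ) : B) • φ) z ∈ I ^ (k + 1) := by
  refine forall_mem_of_forall_tmul (fun w ↦ ?_) z
  have h1 : ∀ i, ∑ j, S.σ (S.e j) *
      φ (1 ⊗ₜ contraction (S.l j) 0 (wedge (S.e i) 0 w)) = 0 := fun i ↦ by
    rw [← apply_koszulD_tmul]
    exact LinearMap.congr_fun hφ _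
  have h2 : ∑ i, S.der i (∑ j, S.σ (S.e j) *
      φ (1 ⊗ₜ contraction (S.l j) 0 (wedge (S.e i) 0 w))) = 0 := by
    simp [h1]
  simp_rw [map_sum, Derivation.leibniz, smul_eq_mul, Finset.sum_add_distrib] at h2
  have h3 : ∑ i, ∑ j, S.σ (S.e j) * S.der i (φ (1 ⊗ₜ contraction (S.l j) 0
      (wedge (S.e i) 0 w))) = ∑ i, S.σ (S.e i) * S.der i (φ (1 ⊗ₜ w)) := by
    rw [← S.sum_sum_σ_mul_der, Finset.sum_comm]
    refine Finset.sum_congr rfl fun j _ ↦ Finset.sum_congr rfl fun i _ ↦ ?_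
    rw [contraction_wedge_zero, tmul_smul, ← mul_smul_comm,
      ← Derivation.map_smul, ← algebraMap_smul B (S.l j (S.e i)) (1 ⊗ₜ[A] w), map_smul,
      algebraMap_smul]
  have h4 : ∑ i, ∑ j, algebraMap A B (S.l i (S.e j)) *
      φ (1 ⊗ₜ contraction (S.l j) 0 (wedge (S.e i) 0 w)) = d * φ (1 ⊗ₜ w) := by
    rw [S.sum_sum_mul_contraction_wedge, ← map_sum, ← tmul_sum]
    simp_rw [contraction_wedge_zero]
    rw [← Finset.sum_smul, hd, Nat.cast_smul_eq_nsmul, tmul_smul, map_nsmul, nsmul_eq_mul]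
  have h5 : (((k + d : ℕ) : B) • φ) (1 ⊗ₜ w) =
      - ((∑ i, S.σ (S.e i) * S.der i (φ (1 ⊗ₜ w)) - k * φ (1 ⊗ₜ w)) +
        ∑ i, ∑ j, φ (1 ⊗ₜ contraction (S.l j) 0 (wedge (S.e i) 0 w)) *
          (S.der i (S.σ (S.e j)) - algebraMap A B (S.l i (S.e j)))) := by
    simp_rw [mul_sub, Finset.sum_sub_distrib]
    simp_rw [mul_comm _ (algebraMap A B _), h4]
    rw [h3] at h2
    simp only [LinearMap.smul_apply, smul_eq_mul, Nat.cast_add]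
    linear_combination h2
  rw [h5]
  refine Ideal.neg_mem_iff _ |>.2 (Ideal.add_mem _ (S.euler_pow k (hφk _)) ?_)
  refine Ideal.sum_mem _ fun i _ ↦ Ideal.sum_mem _ fun j _ ↦ ?_
  rw [pow_succ]
  exact Ideal.mul_mem_mul (hφk _) (S.der_σ _ _)

variable [IsNoetherianRing B] [Module.Finite A E] [Module.Projective A E]
  (hB : ∀ n : ℕ, n ≠ 0 → IsUnit (n : B))

include hd hB in
theorem exists_smul_cocycle_zero (hd0 : d ≠ 0) :
    ∃ f : B, f - 1 ∈ I ∧ ∀ φ : B ⊗[A] (⋀[A]^0 E) →ₗ[B] B, φ ∘ₗ S.koszulD 0 = 0 → f • φ = 0 := by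
  obtain ⟨f, hf, h⟩ := Ideal.exists_smul_mem_of_approx I
    (LinearMap.ker (LinearMap.lcomp B B (S.koszulD 0))) ⊥ bot_le
    (fun k φ ↦ ∀ z, φ z ∈ I ^ k) (fun _ _ ↦ Module.Dual.mem_smul_top_of_forall_mem)
    (fun φ _ z ↦ by simp) fun k φ hφ hφk ↦ by
      obtain ⟨u, hu⟩ := hB (k + d) (by omega)
      refine ⟨0, rfl, fun z ↦ ?_⟩
      have h1 := (I ^ (k + 1)).mul_mem_left (↑u⁻¹ : B) (S.smul_mem_zero hd k hφ hφk z)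
      rwa [← hu, LinearMap.smul_apply, smul_eq_mul, Units.inv_mul_cancel_left,
        ← sub_zero φ] at h1
  exact ⟨f, hf, fun φ hφ ↦ h φ hφ⟩

include hd hB in
theorem exists_smul_cocycle_succ (n : ℕ) (hn : n + 1 < d) :
    ∃ f : B, f - 1 ∈ I ∧ ∀ φ : B ⊗[A] (⋀[A]^(n + 1) E) →ₗ[B] B, φ ∘ₗ S.koszulD (n + 1) = 0 →
      ∃ ψ : B ⊗[A] (⋀[A]^n E) →ₗ[B] B, ψ ∘ₗ S.koszulD n = f • φ := by
  obtain ⟨m, hm⟩ := Nat.exists_eq_add_of_lt hn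
  obtain ⟨f, hf, h⟩ := Ideal.exists_smul_mem_of_approx I
    (LinearMap.ker (LinearMap.lcomp B B (S.koszulD (n + 1))))
    (LinearMap.range (LinearMap.lcomp B B (S.koszulD n))) (by
      rintro _ ⟨ψ, rfl⟩
      ext1
      ext w
      simp [S.koszulD_koszulD (by simpa using hB 2 two_ne_zero)])
    (fun k φ ↦ ∀ z, φ z ∈ I ^ k) (fun _ _ ↦ Module.Dual.mem_smul_top_of_forall_mem)
    (fun φ _ z ↦ by simp) fun k φ hφ hφk ↦ by
      obtain ⟨u, hu⟩ := hB (k + (m + 1)) (by omega)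
      refine ⟨(↑u⁻¹ : B) • S.coDeRham n φ ∘ₗ S.koszulD n, ⟨(↑u⁻¹ : B) • S.coDeRham n φ, rfl⟩,
        fun z ↦ ?_⟩
      have h1 := (I ^ (k + 1)).mul_mem_left (↑u⁻¹ : B)
        (S.smul_sub_coDeRham_succ hd n (m + 1) k (by omega) hφ hφk z)
      rwa [← hu, LinearMap.sub_apply, LinearMap.smul_apply, smul_eq_mul, mul_sub,
        Units.inv_mul_cancel_left] at h1
  exact ⟨f, hf, fun φ hφ ↦ h φ hφ⟩

end Cochains

end EulerCosection

namespace exteriorPower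

variable {A E κ : Type*} [CommRing A] [AddCommGroup E] [Module A E] [Fintype κ]
  (e : κ → E) (l : κ → Module.Dual A E) (hel : ∀ v, ∑ j, l j v • e j = v)

include hel in
/-- The rank of a module with invertible top exterior power is the trace of a dual basis. -/
theorem sum_dual_apply_eq_of_subsingleton {d : ℕ} (htop : Subsingleton (⋀[A]^(d + 1) E))
    (ω : (⋀[A]^d E) ≃ₗ[A] A) : ∑ k, l k (e k) = d := by
  have h1 : (∑ k, l k (e k)) • ω.symm 1 = (d : A) • ω.symm 1 := by
    cases d with
    | zero =>
      rw [Finset.sum_smul, Nat.cast_zero, zero_smul]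
      refine Finset.sum_eq_zero fun k _ ↦ ?_
      rw [← contraction_wedge_zero, Subsingleton.elim (wedge (e k) 0 _) 0, map_zero]
    | succ n =>
      rw [← sum_wedge_contraction e l hel n, Finset.sum_smul]
      refine Finset.sum_congr rfl fun k _ ↦ ?_
      rw [← sub_eq_zero, ← contraction_wedge, Subsingleton.elim (wedge (e k) (n + 1) _) 0,
        map_zero]
  simpa using congrArg ω h1

include hel in
theorem subsingleton_of_lt (hA : ∀ n : ℕ, n ≠ 0 → IsUnit (n : A)) {d : ℕ}
    (htop : Subsingleton (⋀[A]^(d + 1) E)) {n : ℕ} (hn : d < n) : Subsingleton (⋀[A]^n E) := by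
  induction n, hn using Nat.le_induction with
  | base => exact htop
  | succ n _ ih =>
    refine subsingleton_of_forall_eq 0 fun z ↦ (hA (n + 1) n.succ_ne_zero).smul_eq_zero.1 ?_
    rw [← sum_wedge_contraction e l hel n]
    refine Finset.sum_eq_zero fun k _ ↦ ?_
    rw [Subsingleton.elim (contraction (l k) n z) 0, map_zero]

end exteriorPower

section Cohomology

universe u

variable {B : Type u} [CommRing B]

/-- The coboundaries of the complex of linear maps out of `C` with values in `M`. -/
def coboundaries {C : ℕ → Type*} [∀ n, AddCommGroup (C n)] [∀ n, Module B (C n)]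
    (δ : ∀ n, C (n + 1) →ₗ[B] C n) (M : Type*) [AddCommGroup M] [Module B M] :
    ∀ n, Submodule B (C n →ₗ[B] M)
  | 0 => ⊥
  | n + 1 => LinearMap.range (LinearMap.lcomp B M (δ n))

theorem Module.Projective.exists_comp_eq_of_forall_mem {Q X Y : Type*} [AddCommGroup Q]
    [Module B Q] [Module.Projective B Q] [AddCommGroup X] [Module B X] [AddCommGroup Y]
    [Module B Y] (p : X →ₗ[B] Y) (g : Q →ₗ[B] Y) (h : ∀ q, g q ∈ LinearMap.range p) :
    ∃ k : Q →ₗ[B] X, ∀ q, p (k q) = g q := by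
  obtain ⟨k, hk⟩ := Module.projective_lifting_property p.rangeRestrict
    (g.codRestrict (LinearMap.range p) h) p.surjective_rangeRestrict
  exact ⟨k, fun q ↦ congrArg Subtype.val (LinearMap.congr_fun hk q)⟩

section

variable {C : ℕ → Type*} [∀ n, AddCommGroup (C n)] [∀ n, Module B (C n)]
  [∀ n, Module.Projective B (C n)] (δ : ∀ n, C (n + 1) →ₗ[B] C n)
  (hδ : ∀ n z, δ n (δ (n + 1) z) = 0) (f : ℕ → B) (h0 : ∀ z, f 0 • z ∈ LinearMap.range (δ 0))
  (hs : ∀ n z, δ n z = 0 → f (n + 1) • z ∈ LinearMap.range (δ (n + 1)))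

include hδ h0 hs

theorem exists_contraction_up_to_smul (n : ℕ) : ∃ h : C n →ₗ[B] C (n + 1),
    ∀ z, (∏ i ∈ Finset.range (n + 1), f i) • δ n z = δ n (h (δ n z)) := by
  induction n with
  | zero =>
    obtain ⟨h, hh⟩ := Module.Projective.exists_comp_eq_of_forall_mem (δ 0)
      (f 0 • LinearMap.id) h0
    exact ⟨h, fun z ↦ by simp [hh]⟩
  | succ n ih =>
    obtain ⟨h, hh⟩ := ih
    obtain ⟨k, hk⟩ := Module.Projective.exists_comp_eq_of_forall_mem (δ (n + 1))
      (f (n + 1) • ((∏ i ∈ Finset.range (n + 1), f i) • LinearMap.id - h ∘ₗ δ n))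
      fun z ↦ hs n _ (by simp [hh])
    refine ⟨k, fun z ↦ ?_⟩
    rw [hk, Finset.prod_range_succ, mul_comm, mul_smul]
    simp [hδ]

/-- If the homology of a complex of projectives is killed by the elements `f i`, then so is its
cohomology, up to taking products. -/
theorem prod_smul_mem_coboundaries {M : Type*} [AddCommGroup M] [Module B M] (n : ℕ)
    {φ : C n →ₗ[B] M} (hφ : ∀ z, φ (δ n z) = 0) :
    (∏ i ∈ Finset.range (n + 1), f i) • φ ∈ coboundaries δ M n := by
  cases n with
  | zero =>
    refine LinearMap.ext fun z ↦ ?_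
    obtain ⟨w, hw⟩ := h0 z
    simp [← map_smul, ← hw, hφ]
  | succ n =>
    obtain ⟨h, hh⟩ := exists_contraction_up_to_smul δ hδ f h0 hs n
    refine ⟨f (n + 1) • φ ∘ₗ h, LinearMap.ext fun z ↦ ?_⟩
    obtain ⟨w, hw⟩ := hs n ((∏ i ∈ Finset.range (n + 1), f i) • z - h (δ n z)) (by simp [hh])
    have h1 := hφ w
    rw [hw, map_smul, map_sub, smul_sub, sub_eq_zero] at h1
    rw [Finset.prod_range_succ, mul_comm, mul_smul]
    simpa using h1.symm

end

variable {K P : ℕ → Type u} [∀ n, AddCommGroup (K n)] [∀ n, Module B (K n)]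
  [∀ n, AddCommGroup (P n)] [∀ n, Module B (P n)]
  (δ : ∀ n, K (n + 1) →ₗ[B] K n) (p : ∀ n, P (n + 1) →ₗ[B] P n) {N : Type u} [AddCommGroup N]
  [Module B N] (ε : K 0 →ₗ[B] N) (η : P 0 →ₗ[B] N)

/-- The comparison of a complex of projectives with a resolution. -/
theorem exists_chainMap [∀ n, Module.Projective B (K n)] (hδ : ∀ n z, δ n (δ (n + 1) z) = 0)
    (hε : ∀ z, ε (δ 0 z) = 0) (hη : Function.Surjective η)
    (hp0 : ∀ x, η x = 0 → x ∈ LinearMap.range (p 0))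
    (hp : ∀ n x, p n x = 0 → x ∈ LinearMap.range (p (n + 1))) :
    ∃ β : ∀ n, K n →ₗ[B] P n, (∀ z, η (β 0 z) = ε z) ∧
      ∀ n z, p n (β (n + 1) z) = β n (δ n z) := by
  obtain ⟨β₀, hβ₀⟩ := Module.Projective.exists_comp_eq_of_forall_mem η ε fun z ↦ hη _
  obtain ⟨β₁, hβ₁⟩ := Module.Projective.exists_comp_eq_of_forall_mem (p 0) (β₀ ∘ₗ δ 0)
    fun z ↦ hp0 _ (by simp [hβ₀, hε])
  let T (n : ℕ) := { β : (K n →ₗ[B] P n) × (K (n + 1) →ₗ[B] P (n + 1)) //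
    ∀ z, p n (β.2 z) = β.1 (δ n z) }
  have step : ∀ n (t : T n), ∃ t' : T (n + 1), t'.1.1 = t.1.2 := fun n t ↦ by
    obtain ⟨β, hβ⟩ := Module.Projective.exists_comp_eq_of_forall_mem (p (n + 1))
      (t.1.2 ∘ₗ δ (n + 1)) fun z ↦ hp n _ (by simp [t.2, hδ])
    exact ⟨⟨(t.1.2, β), hβ⟩, rfl⟩
  choose s hs using step
  let t (n : ℕ) : T n := Nat.rec ⟨(β₀, β₁), hβ₁⟩ s n
  exact ⟨fun n ↦ (t n).1.1, hβ₀, fun n z ↦ by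
    have h : (t (n + 1)).1.1 = (t n).1.2 := hs n (t n)
    exact (congrArg (fun g ↦ p n (g z)) h).trans ((t n).2 z)⟩

variable (β : ∀ n, K n →ₗ[B] P n)

variable (K P) in
/-- The terms of the mapping cone. -/
def coneX : ℕ → ModuleCat.{u} B
  | 0 => ModuleCat.of B (P 0)
  | n + 1 => ModuleCat.of B (K n × P (n + 1))

/-- The differential of the mapping cone. -/
def coneD : ∀ n, coneX (B := B) K P (n + 1) →ₗ[B] coneX (B := B) K P n
  | 0 => (β 0).coprod (p 0)
  | n + 1 => ((-δ n).comp (LinearMap.fst B _ _)).prod ((β (n + 1)).coprod (p (n + 1)))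

instance coneX_projective [∀ n, Module.Projective B (K n)] [∀ n, Module.Projective B (P n)] :
    ∀ n, Module.Projective B (coneX (B := B) K P n)
  | 0 => inferInstanceAs (Module.Projective B (P 0))
  | n + 1 => inferInstanceAs (Module.Projective B (K n × P (n + 1)))

theorem coneD_coneD (hδ : ∀ n z, δ n (δ (n + 1) z) = 0) (hp : ∀ n x, p n (p (n + 1) x) = 0)
    (hβ : ∀ n z, p n (β (n + 1) z) = β n (δ n z)) (n : ℕ) (z : coneX (B := B) K P (n + 2)) :
    coneD δ p β n (coneD δ p β (n + 1) z) = 0 := by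
  obtain ⟨k, x⟩ := z
  cases n with
  | zero =>
    change β 0 (-δ 0 k) + p 0 (β 1 k + p 1 x) = 0
    rw [map_neg, map_add, hβ, hp]
    abel
  | succ n =>
    refine Prod.ext ?_ ?_
    · change -δ n (-δ (n + 1) k) = 0
      rw [map_neg, hδ, neg_zero, neg_zero]
    · change β (n + 1) (-δ (n + 1) k) + p (n + 1) (β (n + 2) k + p (n + 2) x) = 0
      rw [map_neg, map_add, hβ, hp]
      abel

section

variable (hδ : ∀ n z, δ n (δ (n + 1) z) = 0) (hp : ∀ n x, p n (p (n + 1) x) = 0)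
  (hβ0 : ∀ z, η (β 0 z) = ε z)
  (hβ : ∀ n z, p n (β (n + 1) z) = β n (δ n z)) (hηp : ∀ x, η (p 0 x) = 0)
  (hp0 : ∀ x, η x = 0 → x ∈ LinearMap.range (p 0))
  (hpe : ∀ n x, p n x = 0 → x ∈ LinearMap.range (p (n + 1)))
  (hε : Function.Surjective ε) (f : ℕ → B)
  (hf0 : ∀ z, ε z = 0 → f 0 • z ∈ LinearMap.range (δ 0))
  (hf : ∀ n z, δ n z = 0 → f (n + 1) • z ∈ LinearMap.range (δ (n + 1)))

include hβ0 hp0 hε in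
theorem coneD_surjective (z : coneX (B := B) K P 0) :
    z ∈ LinearMap.range (coneD δ p β 0) := by
  obtain ⟨k, hk⟩ := hε (η (show P 0 from z))
  obtain ⟨x, hx⟩ := hp0 ((show P 0 from z) - β 0 k) (by rw [map_sub, hβ0, hk, sub_self])
  exact ⟨(k, x), show β 0 k + p 0 x = z by rw [hx, add_sub_cancel]⟩

include hβ0 hβ hηp hpe hf0 hf in
theorem smul_mem_range_coneD (n : ℕ) (z : coneX (B := B) K P (n + 1))
    (hz : coneD δ p β n z = 0) : f n • z ∈ LinearMap.range (coneD δ p β (n + 1)) := by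
  obtain ⟨k, x⟩ := z
  have key : β n k + p n x = 0 ∧ f n • k ∈ LinearMap.range (δ n) := by
    cases n with
    | zero =>
      refine ⟨hz, hf0 k ?_⟩
      have h1 := congrArg η (show β 0 k + p 0 x = 0 from hz)
      rwa [map_add, hβ0, hηp, add_zero, map_zero] at h1
    | succ n =>
      exact ⟨congrArg Prod.snd hz, hf n k (neg_eq_zero.1 (congrArg Prod.fst hz))⟩
  obtain ⟨h1, k', hk'⟩ := key
  obtain ⟨x', hx'⟩ := hpe n (f n • x + β (n + 1) k') (by
    rw [map_add, hβ, hk', map_smul, map_smul, ← smul_add, add_comm (p n x), h1, smul_zero])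
  refine ⟨(-k', x'), Prod.ext ?_ ?_⟩
  · change -δ n (-k') = f n • k
    rw [map_neg, neg_neg, hk']
  · change β (n + 1) (-k') + p (n + 1) x' = f n • x
    rw [map_neg, hx']
    abel

variable [∀ n, Module.Projective B (K n)] [∀ n, Module.Projective B (P n)]
  {M : Type*} [AddCommGroup M] [Module B M]

include hδ hp hβ0 hβ hηp hp0 hpe hε hf0 hf

theorem prod_smul_mem_coboundaries_coneD (n : ℕ) {φ : coneX (B := B) K P n →ₗ[B] M}
    (hφ : ∀ z, φ (coneD δ p β n z) = 0) :
    (∏ i ∈ Finset.range n, f i) • φ ∈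
      coboundaries (C := fun n ↦ coneX (B := B) K P n) (coneD δ p β) M n := by
  have h := prod_smul_mem_coboundaries (C := fun n ↦ coneX (B := B) K P n) (coneD δ p β)
    (coneD_coneD δ p β hδ hp hβ)
    (fun n ↦ Nat.casesOn n 1 f)
    (fun z ↦ by
      rw [show (Nat.casesOn 0 1 f : B) = 1 from rfl, one_smul]
      exact coneD_surjective δ p ε η β hβ0 hp0 hε z)
    (fun n z hz ↦ smul_mem_range_coneD δ p ε η β hβ0 hβ hηp hpe f hf0 hf n z hz) n hφ
  rwa [Finset.prod_range_succ', show (Nat.casesOn 0 1 f : B) = 1 from rfl, mul_one] at h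

theorem prod_smul_mem_coboundaries_of_comp (n : ℕ) {φ : P n →ₗ[B] M}
    (hφ : ∀ x, φ (p n x) = 0) (hφβ : φ ∘ₗ β n ∈ coboundaries δ M n) :
    (∏ i ∈ Finset.range n, f i) • φ ∈ coboundaries p M n := by
  cases n with
  | zero =>
    refine prod_smul_mem_coboundaries_coneD δ p ε η β hδ hp hβ0 hβ hηp hp0 hpe hε f hf0 hf 0
      (φ := φ) ?_
    rintro ⟨k, x⟩
    change φ (β 0 k + p 0 x) = 0
    rw [map_add, hφ, add_zero]
    exact LinearMap.congr_fun hφβ k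
  | succ n =>
    obtain ⟨ψ, hψ⟩ := hφβ
    obtain ⟨χ, hχ⟩ := prod_smul_mem_coboundaries_coneD δ p ε η β hδ hp hβ0 hβ hηp hp0 hpe hε f
      hf0 hf (n + 1) (φ := ψ.coprod φ) (by
        rintro ⟨k, x⟩
        change ψ (-δ n k) + φ (β (n + 1) k + p (n + 1) x) = 0
        rw [map_add, hφ, add_zero, map_neg, neg_add_eq_zero]
        exact LinearMap.congr_fun hψ k)
    have h1 : ∀ x, χ (coneD δ p β n (0, x)) = (∏ i ∈ Finset.range (n + 1), f i) • φ x := fun x ↦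
      (LinearMap.congr_fun hχ (0, x)).trans
        (congrArg _ (show ψ 0 + φ x = φ x by rw [map_zero, zero_add]))
    cases n with
    | zero =>
      refine ⟨χ, LinearMap.ext fun x ↦ (congrArg χ ?_).trans (h1 x)⟩
      exact ((congrArg (· + p 0 x) (map_zero (β 0))).trans (zero_add _)).symm
    | succ n =>
      refine ⟨χ.comp (LinearMap.inr B (K n) (P (n + 1))),
        LinearMap.ext fun x ↦ (congrArg χ (Prod.ext ?_ ?_)).trans (h1 x)⟩
      · change 0 = -δ n 0
        rw [map_zero, neg_zero]
      · change p (n + 1) x = β (n + 1) 0 + p (n + 1) x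
        rw [map_zero, zero_add]

theorem exists_cocycle_comp_sub_mem_coboundaries (n : ℕ) {θ : K n →ₗ[B] M}
    (hθ : ∀ z, θ (δ n z) = 0) : ∃ φ : P n →ₗ[B] M, (∀ x, φ (p n x) = 0) ∧
      φ ∘ₗ β n - (∏ i ∈ Finset.range (n + 1), f i) • θ ∈ coboundaries δ M n := by
  obtain ⟨χ, hχ⟩ := prod_smul_mem_coboundaries_coneD δ p ε η β hδ hp hβ0 hβ hηp hp0 hpe hε f
    hf0 hf (n + 1) (φ := θ.coprod (0 : P (n + 1) →ₗ[B] M)) (by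
      rintro ⟨k, x⟩
      change θ (-δ n k) + 0 = 0
      rw [add_zero, map_neg, hθ, neg_zero])
  have h1 : ∀ x, χ (coneD δ p β n (0, x)) = 0 := fun x ↦
    (LinearMap.congr_fun hχ (0, x)).trans
      ((congrArg _ (show θ 0 + 0 = 0 by rw [map_zero, zero_add])).trans (smul_zero _))
  have h2 : ∀ k, χ (coneD δ p β n (k, 0)) = (∏ i ∈ Finset.range (n + 1), f i) • θ k := fun k ↦
    (LinearMap.congr_fun hχ (k, 0)).trans (congrArg _ (add_zero (θ k)))
  cases n with
  | zero =>
    refine ⟨χ, fun x ↦ (congrArg χ ?_).trans (h1 x), LinearMap.ext fun k ↦ ?_⟩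
    · exact ((congrArg (· + p 0 x) (map_zero (β 0))).trans (zero_add _)).symm
    · refine sub_eq_zero.2 ((congrArg χ ?_).trans (h2 k))
      change β 0 k = β 0 k + p 0 0
      rw [map_zero, add_zero]
  | succ n =>
    refine ⟨χ.comp (LinearMap.inr B (K n) (P (n + 1))), fun x ↦
      (congrArg χ (Prod.ext ?_ ?_)).trans (h1 x),
      χ.comp (LinearMap.inl B (K n) (P (n + 1))), LinearMap.ext fun k ↦ ?_⟩
    · change 0 = -δ n 0
      rw [map_zero, neg_zero]
    · change p (n + 1) x = β (n + 1) 0 + p (n + 1) x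
      rw [map_zero, zero_add]
    · refine eq_sub_of_add_eq ((congrArg _ (h2 k).symm).trans
        ((map_add χ _ _).symm.trans (congrArg χ (Prod.ext ?_ ?_))))
      · change δ n k + -δ n k = 0
        rw [add_neg_cancel]
      · change 0 + (β (n + 1) k + p (n + 1) 0) = β (n + 1) k
        rw [map_zero, add_zero, zero_add]

end

end Cohomology

section Cohomology

universe u

theorem Ideal.prod_sub_one_mem {B ι : Type*} [CommRing B] (I : Ideal B) (f : ι → B)
    (hf : ∀ i, f i - 1 ∈ I) (s : Finset ι) : ∏ i ∈ s, f i - 1 ∈ I := by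
  rw [← Ideal.Quotient.eq, map_prod, map_one]
  exact Finset.prod_eq_one fun i _ ↦ Ideal.Quotient.eq.2 (hf i)

variable {B : Type u} [CommRing B]
variable {K P : ℕ → Type u} [∀ n, AddCommGroup (K n)] [∀ n, Module B (K n)]
  [∀ n, AddCommGroup (P n)] [∀ n, Module B (P n)]
  (δ : ∀ n, K (n + 1) →ₗ[B] K n) (p : ∀ n, P (n + 1) →ₗ[B] P n) {N : Type u} [AddCommGroup N]
  [Module B N] (ε : K 0 →ₗ[B] N) (η : P 0 →ₗ[B] N) (β : ∀ n, K n →ₗ[B] P n)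
  {M : Type*} [AddCommGroup M] [Module B M]

variable {δ p} in
theorem comp_mem_coboundaries (hβ : ∀ n z, p n (β (n + 1) z) = β n (δ n z)) {n : ℕ}
    {φ : P n →ₗ[B] M} (hφ : φ ∈ coboundaries p M n) : φ ∘ₗ β n ∈ coboundaries δ M n := by
  cases n with
  | zero => exact (congrArg (· ∘ₗ β 0) (show φ = 0 from hφ)).trans (LinearMap.zero_comp _)
  | succ n =>
    obtain ⟨ψ, rfl⟩ := hφ
    exact ⟨ψ ∘ₗ β n, LinearMap.ext fun z ↦ (congrArg ψ (hβ n z)).symm⟩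

variable (hδ : ∀ n z, δ n (δ (n + 1) z) = 0) (hp : ∀ n x, p n (p (n + 1) x) = 0)
  (hεδ : ∀ z, ε (δ 0 z) = 0) (hηp : ∀ x, η (p 0 x) = 0)
  (hp0 : ∀ x, η x = 0 → x ∈ LinearMap.range (p 0))
  (hpe : ∀ n x, p n x = 0 → x ∈ LinearMap.range (p (n + 1)))
  (hε : Function.Surjective ε) (hη : Function.Surjective η)
  {I : Ideal B} (hI : ∀ b ∈ I, ∀ x : N, b • x = 0)
  [∀ n, Module.Projective B (K n)] [∀ n, Module.Projective B (P n)]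

include hp hp0 hpe hI in
theorem smul_mem_coboundaries_of_mem {n : ℕ} {φ : P n →ₗ[B] M} (hφ : ∀ x, φ (p n x) = 0) {b : B}
    (hb : b ∈ I) : b • φ ∈ coboundaries p M n := by
  have h := prod_smul_mem_coboundaries p hp (fun n ↦ Nat.casesOn n b fun _ ↦ 1)
    (fun z ↦ hp0 (b • z) (by rw [map_smul, hI b hb]))
    (fun n z hz ↦ Submodule.smul_mem _ _ (hpe n z hz)) n hφ
  rwa [Finset.prod_range_succ', Finset.prod_eq_one fun _ _ ↦ rfl, one_mul] at h

include hp hp0 hpe hI in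
theorem mem_coboundaries_of_smul_mem {n : ℕ} {φ : P n →ₗ[B] M} (hφ : ∀ x, φ (p n x) = 0) {g : B}
    (hg : g - 1 ∈ I) (h : g • φ ∈ coboundaries p M n) : φ ∈ coboundaries p M n := by
  have h1 := Submodule.sub_mem _ h (smul_mem_coboundaries_of_mem p η hp hp0 hpe hI hφ hg)
  rwa [sub_smul, one_smul, sub_sub_cancel] at h1

variable (f : ℕ → B) (hfI : ∀ n, f n - 1 ∈ I)
  (hf0 : ∀ z, ε z = 0 → f 0 • z ∈ LinearMap.range (δ 0))
  (hf : ∀ n z, δ n z = 0 → f (n + 1) • z ∈ LinearMap.range (δ (n + 1)))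

include hδ hp hεδ hηp hp0 hpe hε hη hI hfI hf0 hf

theorem mem_coboundaries_of_exists_smul_mem {n : ℕ}
    (hK : ∃ g : B, g - 1 ∈ I ∧
      ∀ θ : K n →ₗ[B] M, θ ∘ₗ δ n = 0 → g • θ ∈ coboundaries δ M n)
    {φ : P n →ₗ[B] M} (hφ : ∀ x, φ (p n x) = 0) : φ ∈ coboundaries p M n := by
  obtain ⟨β, hβ0, hβ⟩ := exists_chainMap δ p ε η hδ hεδ hη hp0 hpe
  obtain ⟨g, hg, hgK⟩ := hK
  refine mem_coboundaries_of_smul_mem p η hp hp0 hpe hI hφ hg ?_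
  have hφ' : ∀ x, (g • φ) (p n x) = 0 := fun x ↦ by rw [LinearMap.smul_apply, hφ, smul_zero]
  refine mem_coboundaries_of_smul_mem p η hp hp0 hpe hI hφ'
    (I.prod_sub_one_mem f hfI (Finset.range n)) ?_
  refine prod_smul_mem_coboundaries_of_comp δ p ε η β hδ hp hβ0 hβ hηp hp0 hpe hε f hf0 hf n
    hφ' ?_
  rw [LinearMap.smul_comp]
  exact hgK _ (LinearMap.ext fun z ↦ by simp [← hβ, hφ])

/-- If `Hom(K, B)` is generated in degree `d` by a cocycle `θ₀`, and coboundaries have coefficients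
in `I`, then the cohomology of `Hom(P, B)` in degree `d` is identified with `B ⧸ I` through the
evaluation at some `x`. -/
theorem exists_forall_mem_coboundaries_iff {d : ℕ} (θ₀ : K d →ₗ[B] B) (k₀ : K d) (hk₀ : θ₀ k₀ = 1)
    (hθ₀ : ∀ θ : K d →ₗ[B] B, θ = θ k₀ • θ₀) (hδd : ∀ z, δ d z = 0)
    (hKd : ∀ θ ∈ coboundaries δ B d, θ k₀ ∈ I) :
    ∃ x : P d, (∀ φ : P d →ₗ[B] B, (∀ y, φ (p d y) = 0) → (φ ∈ coboundaries p B d ↔ φ x ∈ I)) ∧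
      ∃ φ : P d →ₗ[B] B, (∀ y, φ (p d y) = 0) ∧ φ x - 1 ∈ I := by
  obtain ⟨β, hβ0, hβ⟩ := exists_chainMap δ p ε η hδ hεδ hη hp0 hpe
  refine ⟨β d k₀, fun φ hφ ↦ ⟨fun h ↦ hKd _ (comp_mem_coboundaries β hβ h), fun h ↦ ?_⟩, ?_⟩
  · let F : B := ∏ i ∈ Finset.range (d + 1), f i
    have h1 : F • (φ ∘ₗ β d) ∈ coboundaries δ B d := by
      have h2 := prod_smul_mem_coboundaries δ hδ
        (fun n ↦ Nat.casesOn n (f 0 * φ (β d k₀)) fun n ↦ f (n + 1))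
        (fun z ↦ by
          change (f 0 * φ (β d k₀)) • z ∈ _
          rw [mul_smul]
          exact hf0 _ (by rw [map_smul, hI _ h]))
        (fun n z hz ↦ hf n z hz) d (φ := θ₀) (fun z ↦ by rw [hδd, map_zero])
      rw [hθ₀ (φ ∘ₗ β d), LinearMap.comp_apply, smul_smul]
      rw [Finset.prod_range_succ'] at h2
      simp only [F, Finset.prod_range_succ', mul_assoc]
      exact h2
    have hφ' : ∀ x, (F • φ) (p d x) = 0 := fun x ↦ by rw [LinearMap.smul_apply, hφ, smul_zero]
    refine mem_coboundaries_of_smul_mem p η hp hp0 hpe hI hφ (I.prod_sub_one_mem f hfI _)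
      (mem_coboundaries_of_smul_mem p η hp hp0 hpe hI hφ'
        (I.prod_sub_one_mem f hfI (Finset.range d)) ?_)
    refine prod_smul_mem_coboundaries_of_comp δ p ε η β hδ hp hβ0 hβ hηp hp0 hpe hε f hf0 hf d
      hφ' ?_
    rwa [LinearMap.smul_comp]
  · obtain ⟨φ, hφ, hφθ⟩ := exists_cocycle_comp_sub_mem_coboundaries δ p ε η β hδ hp hβ0 hβ hηp
      hp0 hpe hε f hf0 hf d (θ := θ₀) fun z ↦ by rw [hδd, map_zero]
    refine ⟨φ, hφ, ?_⟩
    have h1 := I.add_mem (hKd _ hφθ) (I.prod_sub_one_mem f hfI (Finset.range (d + 1)))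
    simpa [hk₀] using h1

end Cohomology

section Diagonal

variable {R A : Type*} [CommRing R] [CommRing A] [Algebra R A]

/-- The base change to `A` of a derivation of `A`. -/
noncomputable def Derivation.baseChangeSelf (D : Derivation R A A) :
    Derivation A (A ⊗[R] A) (A ⊗[R] A) :=
  Derivation.mk' (D.toLinearMap.baseChange A) fun x y ↦ by
    induction x with
    | zero => simp
    | add x x' hx hx' => simp only [add_mul, map_add, hx, hx', add_smul, smul_add]; abel
    | tmul a b =>
      induction y with
      | zero => simp
      | add y y' hy hy' => simp only [mul_add, map_add, hy, hy', add_smul, smul_add]; abel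
      | tmul c e =>
        simp [tmul_add, mul_comm a c]

theorem Derivation.lmul'_baseChangeSelf (l : Module.Dual A (Ω[A⁄R])) (x : A ⊗[R] A) :
    Algebra.TensorProduct.lmul' R (S := A)
      ((l.compDer (KaehlerDifferential.D R A)).baseChangeSelf x) =
      l ((KaehlerDifferential.D R A).tensorProductTo x) := by
  induction x with
  | zero => simp
  | add x y hx hy => simp only [map_add, hx, hy]
  | tmul a b =>
    rw [Derivation.tensorProductTo_tmul]
    simp [Derivation.baseChangeSelf]

/-- A projective module of differentials has an Euler cosection along the diagonal. -/
theorem exists_eulerCosection [Module.Finite A (Ω[A⁄R])] [Module.Projective A (Ω[A⁄R])] :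
    ∃ n : ℕ, Nonempty (EulerCosection (A := A) (Ω[A⁄R]) (KaehlerDifferential.ideal R A)
      (Fin n)) := by
  obtain ⟨n, f, g, -, -, hfg⟩ := Module.Finite.exists_comp_eq_id_of_projective A (Ω[A⁄R])
  obtain ⟨s, hs⟩ := Module.projective_lifting_property
    ((KaehlerDifferential.fromIdeal R A).restrictScalars A) LinearMap.id
    (KaehlerDifferential.fromIdeal_surjective R A)
  have hs' : ∀ v, (KaehlerDifferential.ideal R A).toCotangent (s v) = v := fun v ↦
    LinearMap.congr_fun hs v
  let l (k : Fin n) : Module.Dual A (Ω[A⁄R]) := LinearMap.proj k ∘ₗ g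
  have hl : ∀ v, ∑ k, l k v • f (Pi.single k 1) = v := fun v ↦ by
    conv_rhs => rw [← LinearMap.id_apply (R := A) v, ← hfg, LinearMap.comp_apply,
      pi_eq_sum_univ' (g v), map_sum]
    simp [l]
  have hder : ∀ k, ∀ y : KaehlerDifferential.ideal R A,
      ((l k).compDer (KaehlerDifferential.D R A)).baseChangeSelf (y : A ⊗[R] A) -
        algebraMap A (A ⊗[R] A) (l k ((KaehlerDifferential.ideal R A).toCotangent y)) ∈
        KaehlerDifferential.ideal R A := fun k y ↦ by
    rw [RingHom.mem_ker, map_sub, Derivation.lmul'_baseChangeSelf,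
      KaehlerDifferential.D_tensorProductTo, sub_eq_zero]
    simp
  refine ⟨n, ⟨{
    e := fun k ↦ f (Pi.single k 1)
    l := l
    sum_l_smul_e := hl
    σ := (KaehlerDifferential.ideal R A).subtype.restrictScalars A ∘ₗ s
    σ_mem := fun v ↦ (s v).2
    der := fun k ↦ ((l k).compDer (KaehlerDifferential.D R A)).baseChangeSelf
    der_σ := fun k v ↦ ?_
    euler := fun y hy ↦ ?_ }⟩⟩
  · conv => enter [2, 2, 2]; rw [← hs' v]
    exact hder k (s v)
  · have h1 := (Ideal.toCotangent_eq _).1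
      (hs' ((KaehlerDifferential.ideal R A).toCotangent ⟨y, hy⟩))
    have h2 : ((s ((KaehlerDifferential.ideal R A).toCotangent ⟨y, hy⟩) : _) : A ⊗[R] A) =
        ∑ k, (s (f (Pi.single k 1)) : A ⊗[R] A) *
          algebraMap A (A ⊗[R] A) (l k ((KaehlerDifferential.ideal R A).toCotangent ⟨y, hy⟩)) := by
      conv_lhs => rw [← hl ((KaehlerDifferential.ideal R A).toCotangent ⟨y, hy⟩), map_sum]
      rw [AddSubmonoidClass.coe_finsetSum]
      refine Finset.sum_congr rfl fun k _ ↦ ?_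
      rw [map_smul, mul_comm, ← Algebra.smul_def]
      rfl
    rw [h2] at h1
    have h3 : ∑ k, (s (f (Pi.single k 1)) : A ⊗[R] A) *
        (((l k).compDer (KaehlerDifferential.D R A)).baseChangeSelf y - algebraMap A (A ⊗[R] A)
          (l k ((KaehlerDifferential.ideal R A).toCotangent ⟨y, hy⟩))) ∈
        KaehlerDifferential.ideal R A ^ 2 := Ideal.sum_mem _ fun k _ ↦ by
      rw [pow_two]
      exact Ideal.mul_mem_mul (s _).2 (hder k ⟨y, hy⟩)
    have h4 := Ideal.add_mem _ h3 h1
    simp_rw [mul_sub, Finset.sum_sub_distrib] at h4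
    rwa [sub_add_sub_cancel] at h4

end Diagonal

theorem isUnit_natCast_of_algebra {A B : Type*} [CommRing A] [CommRing B] [Algebra A B]
    (hA : ∀ n : ℕ, n ≠ 0 → IsUnit (n : A)) (n : ℕ) (hn : n ≠ 0) : IsUnit (n : B) := by
  simpa using (hA n hn).map (algebraMap A B)

namespace EulerCosection

open exteriorPower

universe u

variable {A B E : Type u} [CommRing A] [CommRing B] [Algebra A B] [AddCommGroup E] [Module A E]
  {I : Ideal B} {κ : Type*} [Fintype κ] (S : EulerCosection (A := A) E I κ)
  {N : Type u} [AddCommGroup N] [Module B N] (π : B →ₗ[B] N)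

/-- The augmentation of the Koszul complex. -/
noncomputable def augmentation : B ⊗[A] (⋀[A]^0 E) →ₗ[B] N :=
  π ∘ₗ ((zeroEquiv A E).baseChange A B _ _ ≪≫ₗ AlgebraTensorModule.rid A B B).toLinearMap

variable {π}

theorem augmentation_surjective (hπ : Function.Surjective π) :
    Function.Surjective (augmentation (A := A) (E := E) π) :=
  hπ.comp (LinearEquiv.surjective _)

theorem ker_augmentation (hI : LinearMap.ker π = I) :
    LinearMap.ker (augmentation (A := A) (E := E) π) = I • ⊤ := by
  refine le_antisymm (fun z hz ↦ ?_) (Submodule.smul_le.2 fun b hb z _ ↦ ?_)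
  · have h1 : ((zeroEquiv A E).baseChange A B _ _ ≪≫ₗ AlgebraTensorModule.rid A B B) z ∈ I :=
      hI.le hz
    rw [← LinearEquiv.symm_apply_apply
      ((zeroEquiv A E).baseChange A B _ _ ≪≫ₗ AlgebraTensorModule.rid A B B) z]
    generalize ((zeroEquiv A E).baseChange A B _ _ ≪≫ₗ AlgebraTensorModule.rid A B B) z = b at h1
    rw [← mul_one b, ← smul_eq_mul, map_smul]
    exact Submodule.smul_mem_smul h1 Submodule.mem_top
  · rw [LinearMap.mem_ker, map_smul, augmentation, LinearMap.comp_apply, ← map_smul]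
    exact hI.ge (I.mul_mem_right _ hb)

variable {P : ℕ → Type u} [∀ n, AddCommGroup (P n)] [∀ n, Module B (P n)]
  [∀ n, Module.Projective B (P n)] (p : ∀ n, P (n + 1) →ₗ[B] P n) (η : P 0 →ₗ[B] N)
  (hp : ∀ n x, p n (p (n + 1) x) = 0) (hηp : ∀ x, η (p 0 x) = 0)
  (hp0 : ∀ x, η x = 0 → x ∈ LinearMap.range (p 0))
  (hpe : ∀ n x, p n x = 0 → x ∈ LinearMap.range (p (n + 1)))
  (hη : Function.Surjective η) (hπ : Function.Surjective π) (hI : LinearMap.ker π = I)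
  (hA : ∀ n : ℕ, n ≠ 0 → IsUnit (n : A)) [IsNoetherianRing B] [Module.Finite A E]
  [Module.Projective A E] {d : ℕ} (htop : Subsingleton (⋀[A]^(d + 1) E)) (ω : (⋀[A]^d E) ≃ₗ[A] A)

omit [Module.Projective A E] in
include S hA in
theorem exists_annihilators : ∃ f : ℕ → B, (∀ n, f n - 1 ∈ I) ∧
    (∀ z ∈ (I • ⊤ : Submodule B (B ⊗[A] (⋀[A]^0 E))), f 0 • z ∈ LinearMap.range (S.koszulD 0)) ∧
    ∀ n z, S.koszulD n z = 0 → f (n + 1) • z ∈ LinearMap.range (S.koszulD (n + 1)) := by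
  have hB := isUnit_natCast_of_algebra (B := B) hA
  obtain ⟨f₀, hf₀, h₀⟩ := S.exists_smul_mem_range_zero hB
  choose f hf h using S.exists_smul_mem_range_succ hB
  obtain ⟨f', hf'₀, hf'⟩ : ∃ f' : ℕ → B, f' 0 = f₀ ∧ ∀ n, f' (n + 1) = f n :=
    ⟨fun n ↦ Nat.casesOn n f₀ f, rfl, fun _ ↦ rfl⟩
  refine ⟨f', fun n ↦ ?_, fun z hz ↦ hf'₀ ▸ h₀ z hz, fun n z hz ↦ (hf' n).symm ▸ h n z hz⟩
  cases n with
  | zero => rwa [hf'₀]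
  | succ n => rw [hf']; exact hf n

omit [IsNoetherianRing B] [Module.Finite A E] [Module.Projective A E] in
theorem coboundary_apply_mem (n : ℕ) {θ : B ⊗[A] (⋀[A]^n E) →ₗ[B] B}
    (hθ : θ ∈ coboundaries (C := fun n ↦ B ⊗[A] (⋀[A]^n E)) S.koszulD B n)
    (z : B ⊗[A] (⋀[A]^n E)) : θ z ∈ I := by
  cases n with
  | zero => rw [show θ = 0 from hθ]; exact I.zero_mem
  | succ n =>
    obtain ⟨ψ, rfl⟩ := hθ
    have h1 := Submodule.mem_map_of_mem (f := ψ) (S.koszulD_mem_smul_top n z)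
    rw [Submodule.map_smul''] at h1
    exact Submodule.smul_le.2 (fun b hb c _ ↦ I.mul_mem_right c hb) h1

include S hA htop ω in
theorem exists_smul_mem_coboundaries {n : ℕ} (hn : n ≠ d) : ∃ g : B, g - 1 ∈ I ∧
    ∀ θ : B ⊗[A] (⋀[A]^n E) →ₗ[B] B, θ ∘ₗ S.koszulD n = 0 →
      g • θ ∈ coboundaries (C := fun n ↦ B ⊗[A] (⋀[A]^n E)) S.koszulD B n := by
  have hB := isUnit_natCast_of_algebra (B := B) hA
  have hd := sum_dual_apply_eq_of_subsingleton S.e S.l S.sum_l_smul_e htop ω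
  obtain h | h := hn.lt_or_gt
  · cases n with
    | zero => exact S.exists_smul_cocycle_zero hd hB h.ne'
    | succ n => exact S.exists_smul_cocycle_succ hd hB n h
  · have := subsingleton_of_lt S.e S.l S.sum_l_smul_e hA htop h
    refine ⟨1, by simp, fun θ _ ↦ ?_⟩
    rw [Subsingleton.elim θ 0, smul_zero]
    exact Submodule.zero_mem _

include S hp hηp hp0 hpe hη hπ hI hA htop ω

theorem mem_coboundaries_of_ne {n : ℕ} (hn : n ≠ d) {φ : P n →ₗ[B] B}
    (hφ : ∀ x, φ (p n x) = 0) : φ ∈ coboundaries p B n := by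
  have hB : IsUnit (2 : B) := by simpa using isUnit_natCast_of_algebra (B := B) hA 2 two_ne_zero
  obtain ⟨f, hfI, hf0, hf⟩ := S.exists_annihilators hA
  have hker := ker_augmentation (A := A) (E := E) hI
  exact mem_coboundaries_of_exists_smul_mem (K := fun n ↦ B ⊗[A] (⋀[A]^n E)) S.koszulD p
    (augmentation π) η
    (S.koszulD_koszulD hB) hp (fun z ↦ hker.ge (S.koszulD_mem_smul_top 0 z)) hηp hp0 hpe
    (augmentation_surjective hπ) hη
    (fun b hb x ↦ by
      obtain ⟨c, rfl⟩ := hπ x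
      rw [← map_smul]
      exact hI.ge (I.mul_mem_right c hb)) f hfI (fun z hz ↦ hf0 z (hker.le hz)) hf
    (S.exists_smul_mem_coboundaries hA htop ω hn) hφ

theorem exists_mem_coboundaries_iff :
    ∃ x : P d, (∀ φ : P d →ₗ[B] B, (∀ y, φ (p d y) = 0) → (φ ∈ coboundaries p B d ↔ φ x ∈ I)) ∧
      ∃ φ : P d →ₗ[B] B, (∀ y, φ (p d y) = 0) ∧ φ x - 1 ∈ I := by
  have hB : IsUnit (2 : B) := by simpa using isUnit_natCast_of_algebra (B := B) hA 2 two_ne_zero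
  obtain ⟨f, hfI, hf0, hf⟩ := S.exists_annihilators hA
  have hker := ker_augmentation (A := A) (E := E) hI
  refine exists_forall_mem_coboundaries_iff (K := fun n ↦ B ⊗[A] (⋀[A]^n E)) S.koszulD p
    (augmentation π) η
    (S.koszulD_koszulD hB) hp (fun z ↦ hker.ge (S.koszulD_mem_smul_top 0 z)) hηp hp0 hpe
    (augmentation_surjective hπ) hη
    (fun b hb x ↦ by
      obtain ⟨c, rfl⟩ := hπ x
      rw [← map_smul]
      exact hI.ge (I.mul_mem_right c hb)) f hfI (fun z hz ↦ hf0 z (hker.le hz)) hf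
    (LinearMap.liftBaseChange B (Algebra.linearMap A B ∘ₗ ω.toLinearMap)) (1 ⊗ₜ ω.symm 1)
    (by simp) (fun θ ↦ ?_) (fun z ↦ ?_) fun θ hθ ↦ S.coboundary_apply_mem d hθ _
  · have h1 (w : ⋀[A]^d E) : θ (1 ⊗ₜ w) = algebraMap A B (ω w) * θ (1 ⊗ₜ ω.symm 1) := by
      conv_lhs => rw [← ω.symm_apply_apply w, ← mul_one (ω w), ← smul_eq_mul, map_smul,
        tmul_smul, ← algebraMap_smul B, map_smul, smul_eq_mul]
    ext w
    simpa [mul_comm] using h1 (ιMulti A d w)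
  · rw [Subsingleton.elim z 0, map_zero]

end EulerCosection

section Ext

universe u

theorem CategoryTheory.ShortComplex.nonempty_homology_equiv {R : Type u} [Ring R]
    (S : ShortComplex (ModuleCat.{u} R)) {M : Type*} [AddCommGroup M] [Module R M]
    (F : S.X₂ →ₗ[R] M)
    (hker : ∀ z, S.g z = 0 → (F z = 0 ↔ z ∈ LinearMap.range S.f.hom))
    (hF : ∀ m, ∃ z, S.g z = 0 ∧ F z = m) : Nonempty (S.homology ≃ₗ[R] M) := by
  refine ⟨S.moduleCatHomologyIso.toLinearEquiv ≪≫ₗ Submodule.quotEquivOfEq _ _ ?_ ≪≫ₗ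
    (F ∘ₗ (LinearMap.ker S.g.hom).subtype).quotKerEquivOfSurjective ?_⟩
  · ext ⟨z, hz⟩
    refine Iff.trans ?_ (hker z hz).symm
    exact ⟨fun ⟨y, hy⟩ ↦ ⟨y, congrArg Subtype.val hy⟩, fun ⟨y, hy⟩ ↦ ⟨y, Subtype.ext hy⟩⟩
  · intro m
    obtain ⟨z, hz, rfl⟩ := hF m
    exact ⟨⟨z, hz⟩, rfl⟩

theorem CategoryTheory.ProjectiveResolution.nonempty_ext_equiv {R : Type u} [CommRing R]
    {X Y : ModuleCat.{u} R} (P : ProjectiveResolution X) (n : ℕ)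
    {M : Type*} [AddCommGroup M] [Module R M] (F : (P.complex.X n →ₗ[R] Y) →ₗ[R] M)
    (hker : ∀ φ : P.complex.X n →ₗ[R] Y, (∀ x, φ (P.complex.d (n + 1) n x) = 0) →
      (F φ = 0 ↔ φ ∈ coboundaries (C := fun n ↦ P.complex.X n)
        (fun n ↦ (P.complex.d (n + 1) n).hom) Y n))
    (hF : ∀ m, ∃ φ : P.complex.X n →ₗ[R] Y, (∀ x, φ (P.complex.d (n + 1) n x) = 0) ∧ F φ = m) :
    Nonempty (((Ext R (ModuleCat.{u} R) n).obj (.op X)).obj Y ≃ₗ[R] M) := by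
  let K := P.complex.linearYonedaObj R Y
  have hK (φ : P.complex.X n ⟶ Y) : K.d n (n + 1) φ = 0 ↔
      ∀ x, φ.hom (P.complex.d (n + 1) n x) = 0 :=
    ⟨fun h x ↦ ConcreteCategory.congr_hom (show P.complex.d (n + 1) n ≫ φ = 0 from h) x,
      fun h ↦ ModuleCat.hom_ext (LinearMap.ext h)⟩
  have hF' (m : M) : ∃ φ : P.complex.X n ⟶ Y, K.d n (n + 1) φ = 0 ∧ F φ.hom = m := by
    obtain ⟨φ, hφ, h⟩ := hF m
    exact ⟨ModuleCat.ofHom φ, (hK _).2 hφ, h⟩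
  suffices h : Nonempty (K.homology n ≃ₗ[R] M) from
    h.map fun e ↦ (P.isoExt n Y).toLinearEquiv ≪≫ₗ e
  obtain ⟨i, hi, hi'⟩ : ∃ i, (ComplexShape.up ℕ).prev n = i ∧ ∀ φ : P.complex.X n ⟶ Y,
      φ ∈ LinearMap.range (K.d i n).hom ↔ φ.hom ∈ coboundaries (C := fun n ↦ P.complex.X n)
        (fun n ↦ (P.complex.d (n + 1) n).hom) Y n := by
    cases n with
    | zero =>
      refine ⟨0, by simp, fun φ ↦ ?_⟩
      rw [K.shape 0 0 (by simp), ModuleCat.hom_zero, LinearMap.range_zero]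
      exact ⟨fun h ↦ congrArg ModuleCat.Hom.hom (show φ = 0 from h), fun h ↦ ModuleCat.hom_ext h⟩
    | succ n =>
      exact ⟨n, by simp, fun φ ↦ ⟨fun ⟨ψ, hψ⟩ ↦ ⟨ψ.hom, congrArg ModuleCat.Hom.hom hψ⟩,
        fun ⟨ψ, hψ⟩ ↦ ⟨ModuleCat.ofHom ψ, ModuleCat.hom_ext hψ⟩⟩⟩
  have h := ShortComplex.nonempty_homology_equiv (K.sc' i n (n + 1))
      (F ∘ₗ (ModuleCat.homLinearEquiv (S := R)).toLinearMap)
      (fun φ hφ ↦ (hker _ ((hK φ).1 hφ)).trans (hi' φ).symm) hF'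
  exact h.map fun e ↦ (K.homologyIsoSc' i n (n + 1) hi (by simp)).toLinearEquiv ≪≫ₗ e

namespace CategoryTheory.ProjectiveResolution

variable {R : Type u} [CommRing R] {X : ModuleCat.{u} R} (P : ProjectiveResolution X)

theorem moduleProjective (n : ℕ) : Module.Projective R (P.complex.X n) :=
  (IsProjective.iff_projective _).2 (P.projective n)

theorem mem_range_of_π_eq_zero (x : P.complex.X 0) (hx : (P.π.f 0).hom x = 0) :
    x ∈ LinearMap.range (P.complex.d 1 0).hom :=
  (ShortComplex.moduleCat_exact_iff _).1 P.exact₀ x hx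

theorem mem_range_of_d_eq_zero (n : ℕ) (x : P.complex.X (n + 1))
    (hx : P.complex.d (n + 1) n x = 0) : x ∈ LinearMap.range (P.complex.d (n + 2) (n + 1)).hom :=
  (ShortComplex.moduleCat_exact_iff _).1 (P.exact_succ n) x hx

end CategoryTheory.ProjectiveResolution

end Ext

/-- Let `A` be a finitely generated smooth commutative `ℂ`-algebra whose module of
Kähler differentials `Ω_{A/ℂ}` is finitely generated projective of constant rank `d`
(encoded by `⋀^{d+1} Ω = 0` together with `⋀^d Ω ≅ A`, the trivial canonical module).
Regard `A` as a module over `A ⊗_ℂ A` via the multiplication map.  Then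
`Ext^n_{A⊗A}(A, A⊗A) = 0` for `n ≠ d` and `Ext^d_{A⊗A}(A, A⊗A) ≅ A` as an `A`-module, where
the `A`-module structure on Ext is induced (restriction along `a ↦ 1 ⊗ a`) by the internal
module structure on `A ⊗ A`: `A` is a Calabi–Yau algebra of dimension `d` with free
Van den Bergh dualizing module. -/
theorem smooth_affine_calabiYau
    (A : Type) [CommRing A] [Algebra ℂ A] (d : ℕ)
    [Algebra.FiniteType ℂ A] [Algebra.Smooth ℂ A]
    [Module.Finite A (Ω[A⁄ℂ])] [Module.Projective A (Ω[A⁄ℂ])]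
    (htop : Subsingleton (⋀[A]^(d+1) (Ω[A⁄ℂ])))
    (hcan : Nonempty ((⋀[A]^d (Ω[A⁄ℂ])) ≃ₗ[A] A)) :
    letI : Module (A ⊗[ℂ] A) A :=
      Module.compHom A (Algebra.TensorProduct.lmul' ℂ (S := A)).toRingHom
    (∀ n : ℕ, n ≠ d →
      IsZero (((Ext (A ⊗[ℂ] A) (ModuleCat (A ⊗[ℂ] A)) n).obj
          (Opposite.op (ModuleCat.of (A ⊗[ℂ] A) A))).obj
        (ModuleCat.of (A ⊗[ℂ] A) (A ⊗[ℂ] A)))) ∧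
    (letI : Module A (((Ext (A ⊗[ℂ] A) (ModuleCat (A ⊗[ℂ] A)) d).obj
          (Opposite.op (ModuleCat.of (A ⊗[ℂ] A) A))).obj
        (ModuleCat.of (A ⊗[ℂ] A) (A ⊗[ℂ] A))) :=
      Module.compHom _ (Algebra.TensorProduct.includeRight (R := ℂ) (A := A) (B := A)).toRingHom
    Nonempty ((((Ext (A ⊗[ℂ] A) (ModuleCat (A ⊗[ℂ] A)) d).obj
          (Opposite.op (ModuleCat.of (A ⊗[ℂ] A) A))).obj
        (ModuleCat.of (A ⊗[ℂ] A) (A ⊗[ℂ] A))) ≃ₗ[A] A)) := by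
  let : Module (A ⊗[ℂ] A) A :=
    Module.compHom A (Algebra.TensorProduct.lmul' ℂ (S := A)).toRingHom
  have hA (n : ℕ) (hn : n ≠ 0) : IsUnit (n : A) :=
    isUnit_natCast_of_algebra (A := ℂ) (fun n hn ↦ (Nat.cast_ne_zero.2 hn).isUnit) n hn
  have : IsNoetherianRing (A ⊗[ℂ] A) := by
    have : Algebra.FiniteType ℂ (A ⊗[ℂ] A) := .trans ‹_› (.baseChange A)
    exact Algebra.FiniteType.isNoetherianRing ℂ _
  let I : Ideal (A ⊗[ℂ] A) := KaehlerDifferential.ideal ℂ A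
  let π : A ⊗[ℂ] A →ₗ[A ⊗[ℂ] A] A :=
    { toFun := Algebra.TensorProduct.lmul' ℂ (S := A)
      map_add' := map_add _
      map_smul' := map_mul (Algebra.TensorProduct.lmul' ℂ (S := A)) }
  have hπ : Function.Surjective π := fun a ↦
    ⟨a ⊗ₜ 1, (Algebra.TensorProduct.lmul'_apply_tmul a (1 : A)).trans (mul_one a)⟩
  have hI : LinearMap.ker π = I := rfl
  obtain ⟨m, ⟨S⟩⟩ := exists_eulerCosection (R := ℂ) (A := A)
  obtain ⟨ω⟩ := hcan
  let P := projectiveResolution (ModuleCat.of (A ⊗[ℂ] A) A)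
  have := P.moduleProjective
  let p (n : ℕ) := (P.complex.d (n + 1) n).hom
  have hp (n : ℕ) (x) : p n (p (n + 1) x) = 0 :=
    ConcreteCategory.congr_hom (P.complex.d_comp_d (n + 2) (n + 1) n) x
  have hηp (x) : (P.π.f 0).hom (p 0 x) = 0 :=
    ConcreteCategory.congr_hom P.complex_d_comp_π_f_zero x
  have hη : Function.Surjective (P.π.f 0).hom := (ModuleCat.epi_iff_surjective _).1 inferInstance
  refine ⟨fun n hn ↦ ?_, ?_⟩
  · obtain ⟨e⟩ := P.nonempty_ext_equiv n (Y := ModuleCat.of _ (A ⊗[ℂ] A)) (M := PUnit) 0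
      (fun φ hφ ↦ iff_of_true rfl <| S.mem_coboundaries_of_ne (P := fun n ↦ P.complex.X n) p
        (P.π.f 0).hom hp hηp P.mem_range_of_π_eq_zero P.mem_range_of_d_eq_zero hη hπ hI hA htop ω
        hn hφ) fun _ ↦ ⟨0, by simp, rfl⟩
    have := e.injective.subsingleton
    exact ModuleCat.isZero_of_subsingleton _
  · obtain ⟨x, hx, φ, hφ, hφx⟩ := S.exists_mem_coboundaries_iff (P := fun n ↦ P.complex.X n) p
      (P.π.f 0).hom hp hηp P.mem_range_of_π_eq_zero P.mem_range_of_d_eq_zero hη hπ hI hA htop ω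
    have h1 : π (φ x) = π 1 := by rw [← sub_eq_zero, ← map_sub]; exact hφx
    obtain ⟨e⟩ := P.nonempty_ext_equiv d (Y := ModuleCat.of _ (A ⊗[ℂ] A))
      (π ∘ₗ LinearMap.applyₗ x) (fun ψ hψ ↦ (hx ψ hψ).symm) fun a ↦ by
        obtain ⟨b, rfl⟩ := hπ a
        refine ⟨b • φ, fun y ↦ ?_, ?_⟩
        · rw [LinearMap.smul_apply, hφ, smul_zero]
        · rw [LinearMap.comp_apply, LinearMap.applyₗ_apply_apply, LinearMap.smul_apply, map_smul,
            h1, ← map_smul, smul_eq_mul, mul_one]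
    let : Module A (((Ext (A ⊗[ℂ] A) (ModuleCat (A ⊗[ℂ] A)) d).obj
        (Opposite.op (ModuleCat.of (A ⊗[ℂ] A) A))).obj (ModuleCat.of (A ⊗[ℂ] A) (A ⊗[ℂ] A))) :=
      Module.compHom _ (Algebra.TensorProduct.includeRight (R := ℂ) (A := A) (B := A)).toRingHom
    exact ⟨{ e with
      map_smul' a z := (e.map_smul (1 ⊗ₜ a) z).trans
        (congrArg (· * e z) ((Algebra.TensorProduct.lmul'_apply_tmul 1 a).trans (one_mul a))) }⟩
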